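/- arXiv:2108.07991 — 4 statements merged into one kernel-verified Lean document; each statement's English description precedes it below -/
import Mathlib

section
/- Let R be a commutative Noetherian local ring, 𝔞 an ideal with depth_R(𝔞, R) ≥ 1, and N a finitely generated R-module that is 2-Tor-rigid and generically free (N_𝔭 is free for every minimal prime 𝔭 of R). If M = Ω_R N is nonzero, then depth_R(𝔞, M) ≤ depth_R(𝔞, R) + 1. -/
open CategoryTheory IsLocalRing

section Defs
variable (R : Type) [CommRing R]

/-- vanishing of `Tor_n(M, N)` -/
noncomputable abbrev TorZero [IsNoetherianRing R] (n : ℕ) (M N : ModuleCat.{0} R) : Prop :=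
  Subsingleton (((Tor (ModuleCat.{0} R) n).obj M).obj N)

/-- vanishing of `Ext^n(M, N)` -/
noncomputable abbrev ExtZero (n : ℕ) (M N : ModuleCat.{0} R) : Prop :=
  Subsingleton (((Ext R (ModuleCat.{0} R) n).obj (Opposite.op M)).obj N)

/-- `x` annihilates `Ext^n(M, N)` -/
noncomputable abbrev SMulExtZero (x : R) (n : ℕ) (M N : ModuleCat.{0} R) : Prop :=
  ∀ e : ((Ext R (ModuleCat.{0} R) n).obj (Opposite.op M)).obj N, x • e = 0

/-- `M` is a minimal first syzygy `Ω N` of `N` over the local ring `R`: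
the kernel of a minimal free cover of `N`. -/
def IsSyzygyOf [IsLocalRing R] (N M : ModuleCat.{0} R) : Prop :=
  ∃ (q : ℕ) (g : (Fin q → R) →ₗ[R] N), Function.Surjective g ∧
    (LinearMap.ker g : Submodule R (Fin q → R)) ≤ (maximalIdeal R) • ⊤ ∧
    Nonempty (M ≃ₗ[R] LinearMap.ker g)

/-- `M` is a minimal `n`-th syzygy `Ω^n N` of `N` (with `Ω^0 N = N`). -/
def IsNthSyzygyOf [IsLocalRing R] : ℕ → ModuleCat.{0} R → ModuleCat.{0} R → Prop
  | 0, N, M => Nonempty (M ≃ₗ[R] N)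
  | (n+1), N, M => ∃ K : ModuleCat.{0} R, IsSyzygyOf R N K ∧ IsNthSyzygyOf n K M

/-- `M` and `N` are stably isomorphic (isomorphic up to free direct summands). -/
def StablyIso (M N : ModuleCat.{0} R) : Prop :=
  ∃ p q : ℕ, Nonempty ((↥M × (Fin p → R)) ≃ₗ[R] (↥N × (Fin q → R)))

/-- Tor-rigidity: one vanishing Tor (against any f.g. module) forces all higher ones. -/
noncomputable def TorRigid [IsNoetherianRing R] (M : ModuleCat.{0} R) : Prop :=
  ∀ (N : ModuleCat.{0} R), Module.Finite R N →
    ∀ i : ℕ, 1 ≤ i → TorZero R i M N → ∀ j, i ≤ j → TorZero R j M N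

/-- `n`-Tor-rigidity: `n` consecutive vanishing Tor's force all higher ones. -/
noncomputable def NTorRigid [IsNoetherianRing R] (n : ℕ) (M : ModuleCat.{0} R) : Prop :=
  ∀ (N : ModuleCat.{0} R), Module.Finite R N → ∀ t : ℕ,
    (∀ i, t + 1 ≤ i → i ≤ t + n → TorZero R i M N) → ∀ j, t + 1 ≤ j → TorZero R j M N

/-- the `𝔞`-depth of `M`: `∞` if `𝔞M = M`, otherwise the supremum (= common length) of
maximal `M`-regular sequences contained in `𝔞`. -/
noncomputable def edepth (𝔞 : Ideal R) (M : Type) [AddCommGroup M] [Module R M] : ℕ∞ :=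
  letI := Classical.dec (𝔞 • (⊤ : Submodule R M) = ⊤)
  if 𝔞 • (⊤ : Submodule R M) = ⊤ then ⊤
  else sSup {n : ℕ∞ | ∃ rs : List R, (rs.length : ℕ∞) = n ∧ (∀ r ∈ rs, r ∈ 𝔞) ∧
    RingTheory.Sequence.IsRegular M rs}

/-- `T` is an Auslander transpose of `N`, computed from a minimal free presentation. -/
def IsTransposeOf [IsLocalRing R] (N T : ModuleCat.{0} R) : Prop :=
  ∃ (q p : ℕ) (g : (Fin q → R) →ₗ[R] N) (f : (Fin p → R) →ₗ[R] (Fin q → R)),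
    Function.Surjective g ∧
    LinearMap.range f = LinearMap.ker g ∧
    (LinearMap.ker g : Submodule R (Fin q → R)) ≤ (maximalIdeal R) • ⊤ ∧
    (LinearMap.ker f : Submodule R (Fin p → R)) ≤ (maximalIdeal R) • ⊤ ∧
    Nonempty (T ≃ₗ[R] (Module.Dual R (Fin p → R) ⧸ LinearMap.range f.dualMap))

/-- `depth (R_𝔭)`, the depth of the local ring `R_𝔭`. -/
noncomputable def depthLoc (𝔭 : Ideal R) [𝔭.IsPrime] : ℕ∞ :=
  edepth (Localization.AtPrime 𝔭) (maximalIdeal (Localization.AtPrime 𝔭)) (Localization.AtPrime 𝔭)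

/-- `depth_{R_𝔭} (M_𝔭)`, the depth of the localized module over the localized ring. -/
noncomputable def primeDepth (𝔭 : Ideal R) [𝔭.IsPrime] (M : Type) [AddCommGroup M]
    [Module R M] : ℕ∞ :=
  edepth (Localization.AtPrime 𝔭) (maximalIdeal (Localization.AtPrime 𝔭))
    (LocalizedModule 𝔭.primeCompl M)

/-- A Noetherian local ring is Gorenstein iff `R` has finite injective dimension as an
`R`-module, i.e. `Ext^i(k, R) = 0` for all sufficiently large `i`. -/
noncomputable def IsGorensteinLocal [IsLocalRing R] : Prop :=
  ∃ d : ℕ, ∀ i : ℕ, d < i → ExtZero R i (ModuleCat.of R (R ⧸ maximalIdeal R)) (ModuleCat.of R R)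

/-- An unramified regular local ring: the maximal ideal is generated by `dim R` elements, and
no rational prime that is a nonzero element of the maximal ideal lies in its square. -/
def IsUnramifiedRegularLocal [IsLocalRing R] : Prop :=
  (∃ s : Finset R, Ideal.span (s : Set R) = maximalIdeal R ∧
    (s.card : WithBot ℕ∞) = ringKrullDim R) ∧
  ∀ p : ℕ, p.Prime → (p : R) ≠ 0 → (p : R) ∈ maximalIdeal R → (p : R) ∉ (maximalIdeal R) ^ 2

end Defs

open scoped TensorProduct


section helpers
variable {R : Type} [CommRing R]

/-- For a map `f : A → B` with kernel resolved by `e : E → A`: exactness after tensoring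
versus injectivity on the range. -/
lemma exact_lTensor_iff_range (N : Type) [AddCommGroup N] [Module R N]
    {E A B : Type} [AddCommGroup E] [Module R E] [AddCommGroup A] [Module R A]
    [AddCommGroup B] [Module R B] (e : E →ₗ[R] A) (f : A →ₗ[R] B) (h : Function.Exact e f) :
    Function.Exact (e.lTensor N) (f.lTensor N) ↔
      Function.Injective ((LinearMap.range f).subtype.lTensor N) := by
  have hr : Function.Exact e f.rangeRestrict := by
    intro x
    rw [← h x]
    simp [LinearMap.rangeRestrict, Subtype.ext_iff]
  have hrt := lTensor_exact N hr f.surjective_rangeRestrict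
  have hs := LinearMap.lTensor_surjective N f.surjective_rangeRestrict
  have hc : f.lTensor N = (LinearMap.range f).subtype.lTensor N ∘ₗ f.rangeRestrict.lTensor N := by
    rw [← LinearMap.lTensor_comp]; rfl
  constructor
  · intro hex
    rw [injective_iff_map_eq_zero]
    intro z hz
    obtain ⟨y, rfl⟩ := hs z
    have : f.lTensor N y = 0 := by rw [hc]; exact hz
    exact (hrt y).2 ((hex y).1 this)
  · intro hinj y
    rw [← hrt y, hc, LinearMap.comp_apply]
    exact map_eq_zero_iff _ hinj

/-- `Tor₂`-type shift. -/
lemma shift_iff {M F K P : Type} [AddCommGroup M] [Module R M] [AddCommGroup F] [Module R F]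
    [AddCommGroup K] [Module R K] [AddCommGroup P] [Module R P]
    [Module.Flat R F] [Module.Flat R P] (i : M →ₗ[R] F) (j : K →ₗ[R] P)
    (hi : Function.Injective i) (hj : Function.Injective j) :
    Function.Injective (i.lTensor K) ↔ Function.Injective (j.lTensor M) := by
  rw [LinearMap.lTensor_inj_iff_rTensor_inj]
  have h1 : Function.Injective (j.lTensor F) :=
    Module.Flat.lTensor_preserves_injective_linearMap j hj
  have h2 : Function.Injective (i.rTensor P) :=
    Module.Flat.rTensor_preserves_injective_linearMap i hi
  have hc : j.lTensor F ∘ₗ i.rTensor K = i.rTensor P ∘ₗ j.lTensor M := by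
    rw [LinearMap.lTensor_comp_rTensor, LinearMap.rTensor_comp_lTensor]
  have h3 : Function.Injective (i.rTensor K) ↔ Function.Injective (j.lTensor F ∘ₗ i.rTensor K) := by
    rw [LinearMap.coe_comp, h1.of_comp_iff]
  have h4 : Function.Injective (j.lTensor M) ↔ Function.Injective (i.rTensor P ∘ₗ j.lTensor M) := by
    rw [LinearMap.coe_comp, h2.of_comp_iff]
  rw [h3, h4, hc]

lemma snake {M F N A B C : Type} [AddCommGroup M] [Module R M] [AddCommGroup F] [Module R F]
    [AddCommGroup N] [Module R N] [AddCommGroup A] [Module R A]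
    [AddCommGroup B] [Module R B] [AddCommGroup C] [Module R C]
    {i : M →ₗ[R] F} {p : F →ₗ[R] N} {j : A →ₗ[R] B} {q : B →ₗ[R] C}
    (hip : Function.Exact i p) (hp : Function.Surjective p)
    (hjq : Function.Exact j q) (hq : Function.Surjective q)
    (h1 : Function.Injective (i.lTensor C)) (h2 : Function.Injective (j.lTensor F)) :
    Function.Injective (j.lTensor N) :=
  lTensor_injective_of_exact_of_exact_of_rTensor_injective hip hp hjq hq
    ((LinearMap.lTensor_inj_iff_rTensor_inj _ _).1 h1) h2

lemma snake' {M F N A B C : Type} [AddCommGroup M] [Module R M] [AddCommGroup F] [Module R F]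
    [AddCommGroup N] [Module R N] [AddCommGroup A] [Module R A]
    [AddCommGroup B] [Module R B] [AddCommGroup C] [Module R C]
    {i : M →ₗ[R] F} {p : F →ₗ[R] N} {j : A →ₗ[R] B} {q : B →ₗ[R] C}
    (hip : Function.Exact i p) (hp : Function.Surjective p)
    (hjq : Function.Exact j q) (hq : Function.Surjective q)
    (h1 : Function.Injective (j.lTensor N)) (h2 : Function.Injective (i.lTensor B)) :
    Function.Injective (i.lTensor C) :=
  snake hjq hq hip hp h1 h2

lemma swap_iff {M F N A B C : Type} [AddCommGroup M] [Module R M] [AddCommGroup F] [Module R F]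
    [AddCommGroup N] [Module R N] [AddCommGroup A] [Module R A]
    [AddCommGroup B] [Module R B] [AddCommGroup C] [Module R C]
    [Module.Flat R F] [Module.Flat R B]
    {i : M →ₗ[R] F} {p : F →ₗ[R] N} {j : A →ₗ[R] B} {q : B →ₗ[R] C}
    (hi : Function.Injective i) (hj : Function.Injective j)
    (hip : Function.Exact i p) (hp : Function.Surjective p)
    (hjq : Function.Exact j q) (hq : Function.Surjective q) :
    Function.Injective (j.lTensor N) ↔ Function.Injective (i.lTensor C) :=
  ⟨fun h => snake' hip hp hjq hq h (Module.Flat.lTensor_preserves_injective_linearMap i hi),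
   fun h => snake hip hp hjq hq h (Module.Flat.lTensor_preserves_injective_linearMap j hj)⟩

variable [IsNoetherianRing R]

lemma torZero_succ_iff (N C : ModuleCat.{0} R) (P : ProjectiveResolution C) (n : ℕ) :
    TorZero R (n+1) N C ↔
      Function.Injective ((LinearMap.range (P.complex.d (n+1) n).hom).subtype.lTensor N) := by
  have hex : Function.Exact (P.complex.d (n+2) (n+1)).hom (P.complex.d (n+1) n).hom :=
    (ShortComplex.ShortExact.moduleCat_exact_iff_function_exact _).1 (P.exact_succ n)
  rw [← exact_lTensor_iff_range _ _ _ hex]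
  let G := (MonoidalCategory.tensoringLeft (ModuleCat.{0} R)).obj N
  have e := P.isoLeftDerivedObj G (n+1)
  have : TorZero R (n+1) N C ↔ ((G.mapHomologicalComplex (ComplexShape.down ℕ)).obj P.complex).ExactAt (n+1) := by
    rw [HomologicalComplex.exactAt_iff_isZero_homology]
    unfold TorZero
    rw [← ModuleCat.isZero_iff_subsingleton]
    exact e.isZero_iff
  rw [this, HomologicalComplex.exactAt_iff' _ (n+2) (n+1) n (by simp) (by simp),
    ShortComplex.ShortExact.moduleCat_exact_iff_function_exact]
  rfl

end helpers
section helpers2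
variable {R : Type} [CommRing R]

lemma injective_lTensor_pi {M F A : Type} [AddCommGroup M] [Module R M] [AddCommGroup F] [Module R F]
    [AddCommGroup A] [Module R A] (i : M →ₗ[R] F) (m : ℕ)
    (h : Function.Injective (i.lTensor A)) : Function.Injective (i.lTensor (Fin m → A)) := by
  rw [injective_iff_map_eq_zero]
  intro z hz
  have hid : (LinearMap.id : (Fin m → A) →ₗ[R] (Fin m → A)) =
      ∑ k, LinearMap.single R (fun _ => A) k ∘ₗ LinearMap.proj k := by
    ext k a l
    simp [Finset.sum_apply, Pi.single_apply]
  have hk : ∀ k, (LinearMap.proj k : (Fin m → A) →ₗ[R] A).rTensor M z = 0 := by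
    intro k
    apply h
    rw [map_zero, ← LinearMap.comp_apply, LinearMap.lTensor_comp_rTensor,
      ← LinearMap.rTensor_comp_lTensor, LinearMap.comp_apply, hz, map_zero]
  have : (LinearMap.id : (Fin m → A) →ₗ[R] (Fin m → A)).rTensor M z = 0 := by
    rw [hid]
    simp only [← LinearMap.coe_rTensorHom, map_sum, LinearMap.sum_apply]
    apply Finset.sum_eq_zero
    intro k _
    simp only [LinearMap.coe_rTensorHom, LinearMap.rTensor_comp, LinearMap.comp_apply]
    rw [hk, map_zero]
  simpa using this

lemma nontrivial_tensor [IsLocalRing R] (M E : Type) [AddCommGroup M] [Module R M]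
    [AddCommGroup E] [Module R E] [Module.Finite R M] [Module.Finite R E]
    [Nontrivial M] [Nontrivial E] : Nontrivial (M ⊗[R] E) := by
  have h1 : Nontrivial (ResidueField R ⊗[R] M) := by
    rw [← not_subsingleton_iff_nontrivial, IsLocalRing.subsingleton_tensorProduct,
      not_subsingleton_iff_nontrivial]; assumption
  have h2 : Nontrivial (ResidueField R ⊗[R] E) := by
    rw [← not_subsingleton_iff_nontrivial, IsLocalRing.subsingleton_tensorProduct,
      not_subsingleton_iff_nontrivial]; assumption
  have h3 : Nontrivial ((ResidueField R ⊗[R] M) ⊗[ResidueField R] (ResidueField R ⊗[R] E)) :=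
    (Module.FaithfullyFlat.nontrivial_tensorProduct_iff_right _ _).2 h2
  have e := TensorProduct.AlgebraTensorModule.distribBaseChange R (ResidueField R) M E
  have h4 := e.toEquiv.nontrivial
  rw [← not_subsingleton_iff_nontrivial, IsLocalRing.subsingleton_tensorProduct,
    not_subsingleton_iff_nontrivial] at h4
  exact h4

/-- the elementwise meaning of the multiplication map `A → A^m` after tensoring. -/
lemma mem_ker_mulMap_iff {A : Type} [AddCommGroup A] [Module R A] (Z : Type) [AddCommGroup Z]
    [Module R Z] {m : ℕ} (a : Fin m → R) (z : Z ⊗[R] A) :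
    (LinearMap.pi (fun k => LinearMap.lsmul R A (a k)) : A →ₗ[R] (Fin m → A)).lTensor Z z = 0 ↔
      ∀ k, a k • z = 0 := by
  set φ := (LinearMap.pi (fun k => LinearMap.lsmul R A (a k)) : A →ₗ[R] (Fin m → A)) with hφ
  constructor
  · intro h k
    have : (LinearMap.proj k ∘ₗ φ).lTensor Z z = 0 := by
      rw [LinearMap.lTensor_comp, LinearMap.comp_apply, h, map_zero]
    have h2 : LinearMap.proj k ∘ₗ φ = a k • LinearMap.id := by ext; simp [hφ]
    rw [h2, LinearMap.lTensor_smul] at this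
    simpa using this
  · intro h
    have h2 : φ = ∑ k, a k • LinearMap.single R (fun _ => A) k := by
      ext x l
      simp [hφ, Finset.sum_apply, Pi.single_apply]
    rw [h2]
    simp only [← LinearMap.coe_lTensorHom, map_sum, LinearMap.sum_apply, map_smul,
      LinearMap.smul_apply]
    apply Finset.sum_eq_zero
    intro k _
    rw [← map_smul, h k, map_zero]

variable [IsNoetherianRing R]

lemma range_subtype_exact {C : ModuleCat.{0} R} (P : ProjectiveResolution C) (n : ℕ) :
    Function.Exact (LinearMap.range (P.complex.d (n+2) (n+1)).hom).subtype
      (P.complex.d (n+1) n).hom.rangeRestrict := by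
  have hex : Function.Exact (P.complex.d (n+2) (n+1)).hom (P.complex.d (n+1) n).hom :=
    (ShortComplex.ShortExact.moduleCat_exact_iff_function_exact _).1 (P.exact_succ n)
  intro x
  have := hex x
  simpa [Subtype.ext_iff] using this

instance flat_res {C : ModuleCat.{0} R} (P : ProjectiveResolution C) (n : ℕ) :
    Module.Flat R (P.complex.X n) := by
  have : Module.Projective R (P.complex.X n) := by
    have := P.projective n
    exact (IsProjective.iff_projective (P.complex.X n)).2 this
  infer_instance

lemma torZero_one_iff (N C : ModuleCat.{0} R) {M F : Type} [AddCommGroup M] [Module R M]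
    [AddCommGroup F] [Module R F] [Module.Flat R F]
    {i : M →ₗ[R] F} {p : F →ₗ[R] N} (hi : Function.Injective i)
    (hip : Function.Exact i p) (hp : Function.Surjective p) :
    TorZero R 1 N C ↔ Function.Injective (i.lTensor C) := by
  let P := projectiveResolution C
  rw [torZero_succ_iff N C P 0]
  have h0 : Function.Exact (P.complex.d 1 0).hom (P.π.f 0).hom :=
    (ShortComplex.ShortExact.moduleCat_exact_iff_function_exact _).1 P.exact₀
  have hs : Function.Surjective (P.π.f 0).hom :=
    (ModuleCat.epi_iff_surjective _).1 inferInstance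
  have h1 : Function.Exact (LinearMap.range (P.complex.d 1 0).hom).subtype (P.π.f 0).hom := by
    intro x
    have := h0 x
    simpa using this
  exact swap_iff (C := C) hi Subtype.val_injective hip hp h1 hs

lemma torZero_shift (N M C : ModuleCat.{0} R) {F : Type}
    [AddCommGroup F] [Module R F] [Module.Flat R F]
    {i : M →ₗ[R] F} {p : F →ₗ[R] N} (hi : Function.Injective i)
    (hip : Function.Exact i p) (hp : Function.Surjective p) (n : ℕ) :
    TorZero R (n+2) N C ↔ TorZero R (n+1) M C := by
  let P := projectiveResolution C
  rw [torZero_succ_iff N C P (n+1), torZero_succ_iff M C P n]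
  rw [swap_iff hi Subtype.val_injective hip hp (range_subtype_exact P n)
    (LinearMap.surjective_rangeRestrict _)]
  exact shift_iff _ _ hi Subtype.val_injective

end helpers2
section helpers3
variable {R : Type} [CommRing R]

lemma aux_inj {M F B D : Type} [AddCommGroup M] [Module R M] [AddCommGroup F] [Module R F]
    [AddCommGroup B] [Module R B] [AddCommGroup D] [Module R D]
    [Module.Flat R F] (i : M →ₗ[R] F) (j : B →ₗ[R] D)
    (hj : Function.Injective j) (h : Function.Injective (i.lTensor B)) :
    Function.Injective (j.lTensor M) := by
  rw [LinearMap.lTensor_inj_iff_rTensor_inj] at h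
  have h1 : Function.Injective (j.lTensor F) :=
    Module.Flat.lTensor_preserves_injective_linearMap j hj
  have hc : j.lTensor F ∘ₗ i.rTensor B = i.rTensor D ∘ₗ j.lTensor M := by
    rw [LinearMap.lTensor_comp_rTensor, LinearMap.rTensor_comp_lTensor]
  have h3 : Function.Injective (j.lTensor F ∘ₗ i.rTensor B) := h1.comp h
  rw [hc, LinearMap.coe_comp] at h3
  exact h3.of_comp

lemma aux_inj' {M F B D : Type} [AddCommGroup M] [Module R M] [AddCommGroup F] [Module R F]
    [AddCommGroup B] [Module R B] [AddCommGroup D] [Module R D]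
    (i : M →ₗ[R] F) (j : B →ₗ[R] D)
    (hD : Function.Injective (i.lTensor D)) (h : Function.Injective (j.lTensor M)) :
    Function.Injective (i.lTensor B) := by
  rw [LinearMap.lTensor_inj_iff_rTensor_inj] at hD ⊢
  have hc : j.lTensor F ∘ₗ i.rTensor B = i.rTensor D ∘ₗ j.lTensor M := by
    rw [LinearMap.lTensor_comp_rTensor, LinearMap.rTensor_comp_lTensor]
  have h3 : Function.Injective (i.rTensor D ∘ₗ j.lTensor M) := hD.comp h
  rw [← hc, LinearMap.coe_comp] at h3
  exact h3.of_comp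

lemma torsion_core {M F N A : Type} [AddCommGroup M] [Module R M] [AddCommGroup F] [Module R F]
    [AddCommGroup N] [Module R N] [AddCommGroup A] [Module R A] [Module.Flat R F]
    {i : M →ₗ[R] F} {p : F →ₗ[R] N}
    (hip : Function.Exact i p) (hp : Function.Surjective p)
    (h1 : Function.Injective (i.lTensor A)) {m : ℕ} (a : Fin m → R)
    (hT : ∀ z : M ⊗[R] A, (∀ k, a k • z = 0) → z = 0)
    (hL : ∀ w : N ⊗[R] A, (∀ k, a k • w = 0) →
      ∃ z : F ⊗[R] A, (∀ k, a k • z = 0) ∧ p.rTensor A z = w)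
    (φ : A →ₗ[R] (Fin m → A)) (hφ : φ = LinearMap.pi (fun k => LinearMap.lsmul R A (a k))) :
    Function.Injective ((LinearMap.ker φ).subtype.lTensor N) ∧
    Function.Exact ((LinearMap.ker φ).subtype.lTensor N) (φ.lTensor N) ∧
    ∀ y : M ⊗[R] (LinearMap.ker φ), i.rTensor (LinearMap.ker φ) y = 0 := by
  rw [LinearMap.lTensor_inj_iff_rTensor_inj] at h1
  have hE : Function.Exact (LinearMap.ker φ).subtype φ := LinearMap.exact_subtype_ker_map φ
  have hF : Function.Exact ((LinearMap.ker φ).subtype.lTensor F) (φ.lTensor F) :=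
    Module.Flat.lTensor_exact F hE
  have hFi : Function.Injective ((LinearMap.ker φ).subtype.lTensor F) :=
    Module.Flat.lTensor_preserves_injective_linearMap _ Subtype.val_injective
  have hA := rTensor_exact A hip hp
  have key : ∀ z : F ⊗[R] A, (∀ k, a k • z = 0) → p.rTensor A z = 0 → z = 0 := by
    intro z hz hz0
    obtain ⟨y, rfl⟩ := (hA z).1 hz0
    rw [hT y, map_zero]
    intro k
    apply h1
    rw [map_smul, hz, map_zero]
  have tor : ∀ y : F ⊗[R] (LinearMap.ker φ), ∀ k,
      a k • (LinearMap.ker φ).subtype.lTensor F y = 0 := by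
    intro y
    rw [← mem_ker_mulMap_iff, ← hφ]
    exact (hF _).2 ⟨y, rfl⟩
  have key2 : ∀ y : F ⊗[R] (LinearMap.ker φ),
      (LinearMap.ker φ).subtype.lTensor N (p.rTensor _ y) = 0 → y = 0 := by
    intro y hy
    apply hFi
    rw [map_zero]
    apply key _ (tor y)
    rw [← hy, ← LinearMap.comp_apply, ← LinearMap.comp_apply, LinearMap.rTensor_comp_lTensor,
      LinearMap.lTensor_comp_rTensor]
  refine ⟨?_, ?_, ?_⟩
  · rw [injective_iff_map_eq_zero]
    intro z hz
    obtain ⟨y, rfl⟩ := p.rTensor_surjective (LinearMap.ker φ) hp z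
    rw [key2 y hz, map_zero]
  · intro w
    constructor
    · intro hw
      rw [hφ, mem_ker_mulMap_iff] at hw
      obtain ⟨z, hz, rfl⟩ := hL w hw
      rw [← mem_ker_mulMap_iff, ← hφ] at hz
      obtain ⟨y, rfl⟩ := (hF z).1 hz
      refine ⟨p.rTensor _ y, ?_⟩
      rw [← LinearMap.comp_apply, ← LinearMap.comp_apply, LinearMap.rTensor_comp_lTensor,
        LinearMap.lTensor_comp_rTensor]
    · rintro ⟨y, rfl⟩
      rw [← LinearMap.comp_apply, ← LinearMap.lTensor_comp, hE.linearMap_comp_eq_zero]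
      simp
  · intro y
    apply key2
    rw [← LinearMap.comp_apply (p.rTensor _), ← LinearMap.rTensor_comp,
      hip.linearMap_comp_eq_zero]
    simp

lemma exists_cover [IsNoetherianRing R] (M : Type) [AddCommGroup M] [Module R M]
    [Module.Finite R M] : ∃ (n : ℕ) (g : (Fin n → R) →ₗ[R] M), Function.Surjective g :=
  Module.Finite.exists_fin' R M

lemma endgame [IsNoetherianRing R] [IsLocalRing R] (N : ModuleCat.{0} R)
    (hrig : NTorRigid R 2 N) {M F A : Type} [AddCommGroup M] [Module R M] [Module.Finite R M]
    [Nontrivial M] [AddCommGroup F] [Module R F]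
    [AddCommGroup A] [Module R A] [Module.Finite R A] [Module.Flat R F]
    {i : M →ₗ[R] F} {p : F →ₗ[R] N} (hi : Function.Injective i)
    (hip : Function.Exact i p) (hp : Function.Surjective p)
    (t1 : TorZero R 1 N (ModuleCat.of R A))
    (t2 : TorZero R 2 N (ModuleCat.of R A))
    {m : ℕ} (a : Fin m → R)
    (hT : ∀ z : M ⊗[R] A, (∀ k, a k • z = 0) → z = 0)
    (hL : ∀ w : N ⊗[R] A, (∀ k, a k • w = 0) →
      ∃ z : F ⊗[R] A, (∀ k, a k • z = 0) ∧ p.rTensor A z = w) :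
    ∀ x : A, (∀ k, a k • x = 0) → x = 0 := by
  obtain ⟨φ, hφ⟩ : ∃ φ : A →ₗ[R] (Fin m → A),
    φ = LinearMap.pi (fun k => LinearMap.lsmul R A (a k)) := ⟨_, rfl⟩
  have hA : Function.Injective (i.lTensor A) :=
    (torZero_one_iff N (ModuleCat.of R A) hi hip hp).1 t1
  obtain ⟨c1, c2, c3⟩ := torsion_core hip hp hA a hT hL φ hφ
  obtain ⟨n1, g1, hg1⟩ := exists_cover (R := R) M
  obtain ⟨n2, g2, hg2⟩ := exists_cover (R := R) (LinearMap.ker g1)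
  have e1 := LinearMap.exact_subtype_ker_map g1
  have e2 := LinearMap.exact_subtype_ker_map g2
  have eE := LinearMap.exact_subtype_ker_map φ
  have hA1 : Function.Injective ((LinearMap.ker g1).subtype.lTensor A) := by
    rw [torZero_shift N (ModuleCat.of R M) _ hi hip hp 0] at t2
    exact (torZero_one_iff (ModuleCat.of R M) (ModuleCat.of R A) Subtype.val_injective e1 hg1).1 t2
  have hAm := injective_lTensor_pi i m hA
  have hAm1 := injective_lTensor_pi _ m hA1
  let B := LinearMap.range φ
  have eE' : Function.Exact (LinearMap.ker φ).subtype φ.rangeRestrict := by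
    intro x
    rw [← eE x]
    simp [Subtype.ext_iff]
  have sE := φ.surjective_rangeRestrict
  have eB : Function.Exact B.subtype B.mkQ := LinearMap.exact_subtype_mkQ B
  have sB := B.mkQ_surjective
  have b0 : Function.Injective (B.subtype.lTensor N) :=
    (exact_lTensor_iff_range N _ φ eE).1 c2
  have bi : Function.Injective (i.lTensor B) := snake' hip hp eE' sE c1 hA
  have T1 : TorZero R 1 N (ModuleCat.of R ((Fin m → A) ⧸ B)) :=
    (torZero_one_iff N (ModuleCat.of R ((Fin m → A) ⧸ B)) hi hip hp).2
      (snake' hip hp eB sB b0 hAm)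
  have bM : Function.Injective (B.subtype.lTensor M) :=
    aux_inj i _ Subtype.val_injective bi
  have T2 : TorZero R 2 N (ModuleCat.of R ((Fin m → A) ⧸ B)) := by
    rw [torZero_shift N (ModuleCat.of R M) _ hi hip hp 0]
    exact (torZero_one_iff (ModuleCat.of R M) (ModuleCat.of R ((Fin m → A) ⧸ B))
      Subtype.val_injective e1 hg1).2 (snake' e1 hg1 eB sB bM hAm1)
  have T3 : TorZero R 3 N (ModuleCat.of R ((Fin m → A) ⧸ B)) := by
    refine hrig _ (inferInstanceAs (Module.Finite R ((Fin m → A) ⧸ B))) 0 ?_ 3 (by omega)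
    intro k hk hk2
    have : k = 1 ∨ k = 2 := by omega
    rcases this with rfl | rfl
    · exact T1
    · exact T2
  rw [torZero_shift N (ModuleCat.of R M) _ hi hip hp 1,
    torZero_shift (ModuleCat.of R M) (ModuleCat.of R (LinearMap.ker g1)) _
      (i := (LinearMap.ker g1).subtype) Subtype.val_injective e1 hg1 0] at T3
  have T3' := (torZero_one_iff (ModuleCat.of R (LinearMap.ker g1))
    (ModuleCat.of R ((Fin m → A) ⧸ B)) Subtype.val_injective e2 hg2).1 T3
  have d1 : Function.Injective (B.subtype.lTensor (LinearMap.ker g1)) :=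
    snake e2 hg2 eB sB T3'
      (Module.Flat.lTensor_preserves_injective_linearMap _ Subtype.val_injective)
  have d2 : Function.Injective ((LinearMap.ker g1).subtype.lTensor B) := aux_inj' _ _ hAm1 d1
  have d3 : Function.Injective ((LinearMap.ker φ).subtype.lTensor M) :=
    snake e1 hg1 eE' sE d2
      (Module.Flat.lTensor_preserves_injective_linearMap _ Subtype.val_injective)
  have d4 : Function.Injective (i.lTensor (LinearMap.ker φ)) := aux_inj' _ _ hA d3
  rw [LinearMap.lTensor_inj_iff_rTensor_inj] at d4
  intro x hx
  by_contra hne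
  have : Nontrivial (LinearMap.ker φ) := by
    refine ⟨⟨⟨x, ?_⟩, 0, ?_⟩⟩
    · rw [LinearMap.mem_ker, hφ]
      ext k
      simpa using hx k
    · simpa [Subtype.ext_iff] using hne
  have hnt := nontrivial_tensor (R := R) M (LinearMap.ker φ)
  obtain ⟨y, hy⟩ := exists_ne (0 : M ⊗[R] (LinearMap.ker φ))
  exact hy (d4 (by rw [c3 y, map_zero]))

end helpers3
section helpers4
variable {R : Type} [CommRing R]

/-- the map `R/𝔞 → V` determined by a torsion element. -/
lemma exists_quot_hom {V : Type} [AddCommGroup V] [Module R V] (𝔞 : Ideal R) {m : ℕ}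
    (a : Fin m → R) (ha : Ideal.span (Set.range a) = 𝔞) (z : V) (hz : ∀ k, a k • z = 0) :
    ∃ f : (R ⧸ 𝔞) →ₗ[R] V, f (Ideal.Quotient.mk 𝔞 1) = z := by
  have hle : 𝔞 ≤ LinearMap.ker (LinearMap.toSpanSingleton R V z) := by
    rw [← ha, Ideal.span, Submodule.span_le]
    rintro _ ⟨k, rfl⟩
    simpa using hz k
  refine ⟨Submodule.liftQ 𝔞 (LinearMap.toSpanSingleton R V z) hle, ?_⟩
  exact (Submodule.liftQ_apply 𝔞 (LinearMap.toSpanSingleton R V z) (h := hle) 1).trans (by simp)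

lemma torsion_of_hom {V : Type} [AddCommGroup V] [Module R V] (𝔞 : Ideal R) {m : ℕ}
    (a : Fin m → R) (ha : Ideal.span (Set.range a) = 𝔞) (f : (R ⧸ 𝔞) →ₗ[R] V) (x : R ⧸ 𝔞) (k) :
    a k • f x = 0 := by
  obtain ⟨r, rfl⟩ := Ideal.Quotient.mk_surjective x
  rw [← map_smul]
  have : a k • (Ideal.Quotient.mk 𝔞 r) = 0 := by
    change Ideal.Quotient.mk 𝔞 (a k * r) = 0
    rw [Ideal.Quotient.eq_zero_iff_mem]
    exact 𝔞.mul_mem_right _ (ha ▸ Ideal.subset_span ⟨k, rfl⟩)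
  rw [this, map_zero]

lemma subsingleton_ext_zero_iff {V : Type} [AddCommGroup V] [Module R V] (𝔞 : Ideal R) {m : ℕ}
    (a : Fin m → R) (ha : Ideal.span (Set.range a) = 𝔞) :
    Subsingleton (Abelian.Ext (ModuleCat.of R (R ⧸ 𝔞)) (ModuleCat.of R V) 0) ↔
      ∀ z : V, (∀ k, a k • z = 0) → z = 0 := by
  rw [(Abelian.Ext.addEquiv₀.trans ModuleCat.homAddEquiv).toEquiv.subsingleton_congr]
  constructor
  · intro h z hz
    obtain ⟨f, hf⟩ := exists_quot_hom 𝔞 a ha z hz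
    rw [← hf, Subsingleton.elim (α := (R ⧸ 𝔞) →ₗ[R] V) f 0, LinearMap.zero_apply]
  · intro h
    refine subsingleton_of_forall_eq (0 : (R ⧸ 𝔞) →ₗ[R] V) (fun f => ?_)
    apply LinearMap.ext
    intro x
    exact h _ (torsion_of_hom 𝔞 a ha f x)

lemma lift_torsion {U V W : Type} [AddCommGroup U] [Module R U] [AddCommGroup V] [Module R V]
    [AddCommGroup W] [Module R W] {f : U →ₗ[R] V} {g : V →ₗ[R] W} (hf : Function.Injective f)
    (hfg : Function.Exact f g) (hg : Function.Surjective g) (𝔞 : Ideal R) {m : ℕ}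
    (a : Fin m → R) (ha : Ideal.span (Set.range a) = 𝔞)
    (h : Subsingleton (Abelian.Ext (ModuleCat.of R (R ⧸ 𝔞)) (ModuleCat.of R U) 1))
    (w : W) (hw : ∀ k, a k • w = 0) : ∃ z : V, (∀ k, a k • z = 0) ∧ g z = w := by
  obtain ⟨e, he⟩ := exists_quot_hom 𝔞 a ha w hw
  let S : ShortComplex (ModuleCat.{0} R) :=
    ModuleCat.shortComplexOfCompEqZero f g hfg.linearMap_comp_eq_zero
  have hS : S.ShortExact :=
    { exact := ModuleCat.shortComplex_exact _ hfg
      mono_f := (ModuleCat.mono_iff_injective _).2 hf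
      epi_g := (ModuleCat.epi_iff_surjective _).2 hg }
  obtain ⟨y, hy⟩ := Abelian.Ext.covariant_sequence_exact₃ (ModuleCat.of R (R ⧸ 𝔞)) hS
    (Abelian.Ext.mk₀ (ModuleCat.ofHom e)) (zero_add 1) (h.elim _ _)
  obtain ⟨y', rfl⟩ := (Abelian.Ext.mk₀_bijective _ _).2 y
  rw [Abelian.Ext.mk₀_comp_mk₀] at hy
  have hy' := (Abelian.Ext.mk₀_bijective _ _).1 hy
  refine ⟨y'.hom (Ideal.Quotient.mk 𝔞 1), torsion_of_hom 𝔞 a ha y'.hom _, ?_⟩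
  rw [← he]
  have := congrArg (fun t => t.hom (Ideal.Quotient.mk 𝔞 1)) hy'
  exact this

lemma ext_quot {U V W : Type} [AddCommGroup U] [Module R U] [AddCommGroup V] [Module R V]
    [AddCommGroup W] [Module R W] {f : U →ₗ[R] V} {g : V →ₗ[R] W} (hf : Function.Injective f)
    (hfg : Function.Exact f g) (hg : Function.Surjective g) (X : ModuleCat.{0} R) (n : ℕ)
    (h0 : Subsingleton (Abelian.Ext X (ModuleCat.of R V) n))
    (h : Subsingleton (Abelian.Ext X (ModuleCat.of R U) (n+1))) :
    Subsingleton (Abelian.Ext X (ModuleCat.of R W) n) := by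
  let S : ShortComplex (ModuleCat.{0} R) :=
    ModuleCat.shortComplexOfCompEqZero f g hfg.linearMap_comp_eq_zero
  have hS : S.ShortExact :=
    { exact := ModuleCat.shortComplex_exact _ hfg
      mono_f := (ModuleCat.mono_iff_injective _).2 hf
      epi_g := (ModuleCat.epi_iff_surjective _).2 hg }
  refine subsingleton_of_forall_eq 0 (fun y => ?_)
  obtain ⟨z, hz⟩ := Abelian.Ext.covariant_sequence_exact₃ X hS y rfl (h.elim _ _)
  rw [← hz, h0.elim z 0, Abelian.Ext.zero_comp]

lemma ext_lower {A : Type} [AddCommGroup A] [Module R A] (X : ModuleCat.{0} R) (x : R)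
    (hx : x ∈ Module.annihilator R X) (hreg : IsSMulRegular A x) (n : ℕ)
    (h : Subsingleton (Abelian.Ext X (ModuleCat.of R (QuotSMulTop x A)) n)) :
    Subsingleton (Abelian.Ext X (ModuleCat.of R A) (n+1)) := by
  refine subsingleton_of_forall_eq 0 (fun y => ?_)
  have hS := IsSMulRegular.smulShortComplex_shortExact (M := ModuleCat.of R A) hreg
  have hz : y.comp (Abelian.Ext.mk₀ (x • 𝟙 (ModuleCat.of R A))) (add_zero (n+1)) = 0 := by
    have := Abelian.Ext.postcomp_smul_id_eq_zero_of_mem_annihilator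
      (M := ModuleCat.of R A) (N := X) hx (n+1)
    exact congrArg (fun t => t.hom y) this
  obtain ⟨z, hz⟩ := Abelian.Ext.covariant_sequence_exact₁ X hS y hz rfl
  rw [← hz]
  have : z = 0 := h.elim z 0
  rw [this, Abelian.Ext.zero_comp]
  rfl

end helpers4
section helpers5
open scoped Pointwise
variable {R : Type} [CommRing R]

lemma smul_exact (x : R) (A Z : Type) [AddCommGroup A] [Module R A] [AddCommGroup Z] [Module R Z] :
    Function.Exact ((LinearMap.lsmul R A x).lTensor Z)
      ((x • (⊤ : Submodule R A)).mkQ.lTensor Z) :=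
  lTensor_exact Z (LinearMap.exact_lsmul_mkQ_smul_top A x) (Submodule.mkQ_surjective _)

lemma lsmul_lTensor_injective {x : R} {A Z : Type} [AddCommGroup A] [Module R A] [AddCommGroup Z]
    [Module R Z] (h : IsSMulRegular (Z ⊗[R] A) x) :
    Function.Injective ((LinearMap.lsmul R A x).lTensor Z) := by
  have : (LinearMap.lsmul R A x).lTensor Z = LinearMap.lsmul R (Z ⊗[R] A) x := by
    ext; simp
  rw [this]
  exact h

lemma descent [IsNoetherianRing R] [IsLocalRing R] (N : ModuleCat.{0} R) [Module.Finite R N]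
    (hrig : NTorRigid R 2 N) {M F : Type} [AddCommGroup M] [Module R M] [Module.Finite R M]
    [Nontrivial M] [AddCommGroup F] [Module R F] [Module.Flat R F]
    {i : M →ₗ[R] F} {p : F →ₗ[R] N} (hi : Function.Injective i)
    (hip : Function.Exact i p) (hp : Function.Surjective p)
    (𝔞 : Ideal R) {m : ℕ} (a : Fin m → R) (ha : Ideal.span (Set.range a) = 𝔞) (n : ℕ) :
    ∀ (A : Type) [AddCommGroup A] [Module R A] [Module.Finite R A],
    TorZero R 1 N (ModuleCat.of R A) → TorZero R 2 N (ModuleCat.of R A) →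
    (∀ k < n + 2, Subsingleton
      (Abelian.Ext (ModuleCat.of R (R ⧸ 𝔞)) (ModuleCat.of R (M ⊗[R] A)) k)) →
    (∀ k < n, Subsingleton (Abelian.Ext (ModuleCat.of R (R ⧸ 𝔞)) (ModuleCat.of R A) k)) →
    Subsingleton (Abelian.Ext (ModuleCat.of R (R ⧸ 𝔞)) (ModuleCat.of R A) n) := by
  induction n with
  | zero =>
    intro A _ _ _ t1 t2 hM _
    have hA : Function.Injective (i.lTensor A) :=
      (torZero_one_iff N (ModuleCat.of R A) hi hip hp).1 t1
    rw [subsingleton_ext_zero_iff 𝔞 a ha]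
    refine endgame N hrig hi hip hp t1 t2 a
      ((subsingleton_ext_zero_iff 𝔞 a ha).1 (hM 0 (by omega))) ?_
    exact lift_torsion ((LinearMap.lTensor_inj_iff_rTensor_inj _ _).1 hA)
      (rTensor_exact A hip hp) (p.rTensor_surjective A hp) 𝔞 a ha (hM 1 (by omega))
  | succ n ih =>
    intro A _ _ _ t1 t2 hM hA0
    have hA : Function.Injective (i.lTensor A) :=
      (torZero_one_iff N (ModuleCat.of R A) hi hip hp).1 t1
    have hA' := (LinearMap.lTensor_inj_iff_rTensor_inj _ _).1 hA
    have tfA := (subsingleton_ext_zero_iff (V := A) 𝔞 a ha).1 (hA0 0 (by omega))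
    have tfF : ∀ z : F ⊗[R] A, (∀ k, a k • z = 0) → z = 0 := by
      intro z hz
      rw [← mem_ker_mulMap_iff] at hz
      refine (map_eq_zero_iff _ ?_).1 hz
      apply Module.Flat.lTensor_preserves_injective_linearMap
      rw [injective_iff_map_eq_zero]
      intro y hy
      exact tfA y (fun k => congrFun hy k)
    have tfN : ∀ w : N ⊗[R] A, (∀ k, a k • w = 0) → w = 0 := by
      intro w hw
      obtain ⟨z, hz, rfl⟩ := lift_torsion hA'
        (rTensor_exact A hip hp) (p.rTensor_surjective A hp) 𝔞 a ha (hM 1 (by omega)) w hw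
      rw [tfF z hz, map_zero]
    have hsub : Subsingleton ((R ⧸ 𝔞) →ₗ[R] (A × (N ⊗[R] A))) := by
      refine subsingleton_of_forall_eq 0 (fun f => LinearMap.ext fun y => ?_)
      have := torsion_of_hom 𝔞 a ha f y
      exact Prod.ext (tfA _ fun k => congrArg Prod.fst (this k))
        (tfN _ fun k => congrArg Prod.snd (this k))
    obtain ⟨x, hxX, hx⟩ := IsSMulRegular.subsingleton_linearMap_iff.1 hsub
    have hxA : IsSMulRegular A x := by
      intro u v huv
      have := @hx (u, 0) (v, 0) (Prod.ext huv rfl)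
      exact congrArg Prod.fst this
    have hxN : IsSMulRegular (N ⊗[R] A) x := by
      intro u v huv
      have := @hx (0, u) (0, v) (Prod.ext rfl huv)
      exact congrArg Prod.snd this
    have hxM : IsSMulRegular (M ⊗[R] A) x :=
      (IsSMulRegular.lTensor F hxA).of_injective (i.rTensor A) hA'
    have jN := lsmul_lTensor_injective hxN
    have jM := lsmul_lTensor_injective hxM
    have eA := LinearMap.exact_lsmul_mkQ_smul_top A x
    have sA := Submodule.mkQ_surjective (x • (⊤ : Submodule R A))
    obtain ⟨n1, g1, hg1⟩ := exists_cover (R := R) M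
    have e1 := LinearMap.exact_subtype_ker_map g1
    have hA1 : Function.Injective ((LinearMap.ker g1).subtype.lTensor A) := by
      rw [torZero_shift N (ModuleCat.of R M) _ hi hip hp 0] at t2
      exact (torZero_one_iff (ModuleCat.of R M) (ModuleCat.of R A)
        Subtype.val_injective e1 hg1).1 t2
    have T1 : TorZero R 1 N (ModuleCat.of R (QuotSMulTop x A)) :=
      (torZero_one_iff N (ModuleCat.of R (QuotSMulTop x A)) hi hip hp).2
        (snake' hip hp eA sA jN hA)
    have T2 : TorZero R 2 N (ModuleCat.of R (QuotSMulTop x A)) := by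
      rw [torZero_shift N (ModuleCat.of R M) _ hi hip hp 0]
      exact (torZero_one_iff (ModuleCat.of R M) (ModuleCat.of R (QuotSMulTop x A))
        Subtype.val_injective e1 hg1).2 (snake' e1 hg1 eA sA jM hA1)
    refine ext_lower _ x hxX hxA n (ih (QuotSMulTop x A) T1 T2 ?_ ?_)
    · intro k hk
      exact ext_quot jM (smul_exact x A M) (LinearMap.lTensor_surjective M sA) _ k
        (hM k (by omega)) (hM (k+1) (by omega))
    · intro k hk
      exact ext_quot (f := LinearMap.lsmul R A x) hxA eA sA _ k
        (hA0 k (by omega)) (hA0 (k+1) (by omega))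

end helpers5

/-- the main theorem for first syzygies of 2-Tor-rigid, generically free modules. -/
theorem depth_le_of_two_tor_rigid
    (R : Type) [CommRing R] [IsNoetherianRing R] [IsLocalRing R]
    (𝔞 : Ideal R) (h𝔞 : 1 ≤ edepth R 𝔞 R)
    (N : ModuleCat.{0} R) [Module.Finite R N]
    (hrig : NTorRigid R 2 N)
    (hgen : ∀ (𝔭 : Ideal R) [𝔭.IsPrime], 𝔭 ∈ minimalPrimes R →
      Module.Free (Localization.AtPrime 𝔭) (LocalizedModule 𝔭.primeCompl N))
    (M : ModuleCat.{0} R) (hM : IsSyzygyOf R N M) [Nontrivial M] :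
    edepth R 𝔞 M ≤ edepth R 𝔞 R + 1 := by
  obtain ⟨q, g, hg, -, ⟨e⟩⟩ := hM
  by_contra! hlt
  by_cases htop : 𝔞 = ⊤
  · have : edepth R 𝔞 R = ⊤ := by simp [edepth, htop]
    simp [this] at hlt
  have hle : 𝔞 ≤ maximalIdeal R := IsLocalRing.le_maximalIdeal htop
  have hsm : ∀ (V : Type) [AddCommGroup V] [Module R V] [Module.Finite R V] [Nontrivial V],
      𝔞 • (⊤ : Submodule R V) ≠ ⊤ := by
    intro V _ _ _ _ h
    have := Submodule.eq_bot_of_le_smul_of_le_jacobson_bot 𝔞 (⊤ : Submodule R V)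
      Module.Finite.fg_top h.ge (hle.trans (IsLocalRing.maximalIdeal_le_jacobson _))
    exact top_ne_bot this
  have hMf : Module.Finite R M := Module.Finite.equiv e.symm
  have hKn : Nontrivial (LinearMap.ker g) := e.symm.toEquiv.nontrivial
  have hne : edepth R 𝔞 R ≠ ⊤ := by
    intro h
    simp [h] at hlt
  obtain ⟨n0, hn0⟩ := ENat.ne_top_iff_exists.1 hne
  rw [← hn0] at hlt
  -- vanishing of Ext into M
  have hExtM : ∀ k < n0 + 2, Subsingleton (Abelian.Ext (ModuleCat.of R (R ⧸ 𝔞))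
      (ModuleCat.of R (LinearMap.ker g ⊗[R] R)) k) := by
    unfold edepth at hlt
    rw [if_neg (hsm M), lt_sSup_iff] at hlt
    obtain ⟨_, ⟨rs, rfl, hmem, hreg⟩, hlen⟩ := hlt
    have hlen' : n0 + 1 < rs.length := by exact_mod_cast hlen
    intro k hk
    let e' : M ≃ₗ[R] (LinearMap.ker g ⊗[R] R) := e.trans (TensorProduct.rid R _).symm
    have : Nontrivial (LinearMap.ker g ⊗[R] R) := e'.symm.toEquiv.nontrivial
    refine ModuleCat.subsingleton_ext_of_exists_isRegular 𝔞 (ModuleCat.of R (R ⧸ 𝔞)) ?_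
      (ModuleCat.of R (LinearMap.ker g ⊗[R] R)) (hsm _).lt_top rs hmem
      ((e'.isRegular_congr rs).1 hreg) k (by omega)
    change Module.support R (R ⧸ 𝔞) ⊆ _
    rw [Module.support_eq_zeroLocus, Ideal.annihilator_quotient]
  -- nonvanishing of some Ext into R
  have hExtR : ∃ k, k ≤ n0 ∧ ¬ Subsingleton (Abelian.Ext (ModuleCat.of R (R ⧸ 𝔞))
      (ModuleCat.of R R) k) := by
    by_contra! hall
    obtain ⟨rs, hl, hmem, hreg⟩ := ModuleCat.exists_isRegular_of_exists_subsingleton_ext 𝔞 (n0+1)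
      (ModuleCat.of R R) (hsm R).lt_top (ModuleCat.of R (R ⧸ 𝔞))
      (by change Module.support R (R ⧸ 𝔞) = _
          rw [Module.support_eq_zeroLocus, Ideal.annihilator_quotient])
      (fun k hk => not_nontrivial_iff_subsingleton.1 (fun h => by
        have := hall k (by omega)
        exact not_subsingleton _ this))
    have : ((n0 + 1 : ℕ) : ℕ∞) ≤ edepth R 𝔞 R := by
      unfold edepth
      rw [if_neg (hsm R)]
      exact le_sSup ⟨rs, by rw [hl], hmem, hreg⟩
    rw [← hn0] at this
    have : n0 + 1 ≤ n0 := by exact_mod_cast this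
    omega
  classical
  obtain ⟨m, a, ha⟩ := Submodule.fg_iff_exists_fin_generating_family.1 (IsNoetherian.noetherian 𝔞)
  have hn := Nat.find_spec hExtR
  have hmin : ∀ k < Nat.find hExtR, Subsingleton (Abelian.Ext (ModuleCat.of R (R ⧸ 𝔞))
      (ModuleCat.of R R) k) := by
    intro k hk
    have := Nat.find_min hExtR hk
    by_contra h
    exact this ⟨by omega, h⟩
  have t : ∀ k, TorZero R (k+1) N (ModuleCat.of R R) := by
    intro k
    have : Projective (ModuleCat.of R R) := 
      (IsProjective.iff_projective (ModuleCat.of R R)).1 (inferInstanceAs (Module.Projective R R))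
    exact (ModuleCat.isZero_iff_subsingleton).1 (isZero_Tor_succ_of_projective (ModuleCat.{0} R) N _ k)
  exact hn.2 (descent N hrig (i := (LinearMap.ker g).subtype) Subtype.val_injective
    (LinearMap.exact_subtype_ker_map g) hg 𝔞 a ha _ R (t 0) (t 1)
    (fun k hk => hExtM k (by omega)) hmin)
end

section
/- Let R be a commutative Noetherian local ring, N a finitely generated R-module that is 2-Tor-rigid, and suppose there is an R-regular element x with x · Ext_R^1(N, Ω_R N) = 0. Then M/xM is a Tor-rigid R-module, where M = Ω_R N. -/
open CategoryTheory IsLocalRing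

section TR
open CategoryTheory Limits MonoidalCategory
variable {R : Type} [CommRing R] [IsNoetherianRing R]

/-- Complex computing Tor. -/
noncomputable abbrev tc (P : ChainComplex (ModuleCat.{0} R) ℕ) (A : ModuleCat.{0} R) :
    ChainComplex (ModuleCat.{0} R) ℕ :=
  (((tensoringLeft (ModuleCat.{0} R)).obj A).mapHomologicalComplex _).obj P

lemma torZero_iff {L : ModuleCat.{0} R} (P : ProjectiveResolution L) (n : ℕ) (A : ModuleCat.{0} R) :
    TorZero R n A L ↔ IsZero ((tc P.complex A).homology n) := by
  unfold TorZero
  rw [← ModuleCat.isZero_iff_subsingleton]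
  exact (P.isoLeftDerivedObj ((tensoringLeft (ModuleCat.{0} R)).obj A) n).isZero_iff

/-- Map on complexes. -/
noncomputable abbrev tcMap (P : ChainComplex (ModuleCat.{0} R) ℕ) {A B : ModuleCat.{0} R}
    (f : A ⟶ B) : tc P A ⟶ tc P B :=
  (NatTrans.mapHomologicalComplex ((tensoringLeft (ModuleCat.{0} R)).map f) _).app P

lemma tcMap_comp (P : ChainComplex (ModuleCat.{0} R) ℕ) {A B C : ModuleCat.{0} R}
    (f : A ⟶ B) (g : B ⟶ C) : tcMap P (f ≫ g) = tcMap P f ≫ tcMap P g := by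
  ext i : 1
  simp [tcMap]

lemma tcMap_zero (P : ChainComplex (ModuleCat.{0} R) ℕ) {A B : ModuleCat.{0} R} :
    tcMap P (0 : A ⟶ B) = 0 := by
  ext i : 1
  simp [tcMap]
  rfl

/-- Short complex of complexes. -/
noncomputable def tcSC (P : ChainComplex (ModuleCat.{0} R) ℕ)
    (S : ShortComplex (ModuleCat.{0} R)) :
    ShortComplex (ChainComplex (ModuleCat.{0} R) ℕ) :=
  ShortComplex.mk (tcMap P S.f) (tcMap P S.g) (by rw [← tcMap_comp, S.zero, tcMap_zero])

lemma tcSC_shortExact {L : ModuleCat.{0} R} (P : ProjectiveResolution L)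
    {S : ShortComplex (ModuleCat.{0} R)} (hS : S.ShortExact) : (tcSC P.complex S).ShortExact := by
  apply HomologicalComplex.shortExact_of_degreewise_shortExact
  intro i
  have hp := P.projective i
  have : Module.Projective R (P.complex.X i) := (IsProjective.iff_projective _).2 hp
  have : Module.Flat R (P.complex.X i) := inferInstance
  exact hS.map_of_exact (tensorRight (P.complex.X i))

variable {L : ModuleCat.{0} R}

lemma tor_mid {S : ShortComplex (ModuleCat.{0} R)} (hS : S.ShortExact) {n : ℕ} (h1 : TorZero R n S.X₁ L) (h3 : TorZero R n S.X₃ L) :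
    TorZero R n S.X₂ L := by
  let P := projectiveResolution L
  rw [torZero_iff P] at *
  exact ((tcSC_shortExact P hS).homology_exact₂ n).isZero_of_both_zeros (h1.eq_of_src _ _) (h3.eq_of_tgt _ _)

lemma tor_right {S : ShortComplex (ModuleCat.{0} R)} (hS : S.ShortExact) {n : ℕ} (h2 : TorZero R (n+1) S.X₂ L) (h1 : TorZero R n S.X₁ L) :
    TorZero R (n+1) S.X₃ L := by
  let P := projectiveResolution L
  rw [torZero_iff P] at *
  exact ((tcSC_shortExact P hS).homology_exact₃ (n+1) n (by simp)).isZero_of_both_zeros (h2.eq_of_src _ _) (h1.eq_of_tgt _ _)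

lemma tor_left {S : ShortComplex (ModuleCat.{0} R)} (hS : S.ShortExact) {n : ℕ} (h3 : TorZero R (n+1) S.X₃ L) (h2 : TorZero R n S.X₂ L) :
    TorZero R n S.X₁ L := by
  let P := projectiveResolution L
  rw [torZero_iff P] at *
  exact ((tcSC_shortExact P hS).homology_exact₁ (n+1) n (by simp)).isZero_of_both_zeros (h3.eq_of_src _ _) (h2.eq_of_tgt _ _)

lemma tor_retract {n : ℕ} {A B : ModuleCat.{0} R} (s : A ⟶ B) (r : B ⟶ A) (h : s ≫ r = 𝟙 A)
    (hB : TorZero R n B L) : TorZero R n A L := by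
  unfold TorZero at *
  rw [← ModuleCat.isZero_iff_subsingleton] at *
  let F := (Tor (ModuleCat.{0} R) n).flip.obj L
  rw [IsZero.iff_id_eq_zero]
  have : F.map s ≫ F.map r = 𝟙 (F.obj A) := by rw [← F.map_comp, h, F.map_id]
  change 𝟙 (F.obj A) = 0
  rw [← this, hB.eq_of_tgt (F.map s) 0, zero_comp]

lemma tor_flat (n : ℕ) (A : ModuleCat.{0} R) [Module.Flat R A] : TorZero R (n+1) A L := by
  let P := projectiveResolution L
  rw [torZero_iff P]
  rw [← HomologicalComplex.exactAt_iff_isZero_homology]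
  have := P.complex_exactAt_succ n
  exact this.map (tensorLeft A)

lemma ext_cob {R : Type} [CommRing R] {N M : ModuleCat.{0} R} (P : ProjectiveResolution N)
    (x : R) (hann : SMulExtZero R x 1 N M) (c : P.complex.X 1 ⟶ M)
    (hc : P.complex.d 2 1 ≫ c = 0) : ∃ k : P.complex.X 0 ⟶ M, P.complex.d 1 0 ≫ k = x • c := by
  let K := P.complex.linearYonedaObj R M
  have hH : ∀ e : K.homology 1, x • e = 0 := by
    intro e
    have h := hann ((P.isoExt (R := R) 1 M).inv e)
    have h2 := congrArg (P.isoExt (R := R) 1 M).hom h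
    rw [map_smul, map_zero] at h2
    rwa [Iso.inv_hom_id_apply] at h2
  have hcyc : (ModuleCat.ofHom (LinearMap.toSpanSingleton R _ c) : ModuleCat.of R R ⟶ K.X 1) ≫
      K.d 1 2 = 0 := by
    ext
    change P.complex.d 2 1 ≫ ((1 : R) • c) = 0
    rw [one_smul, hc]
  let z : K.cycles 1 := (K.liftCycles (A := ModuleCat.of R R) (k := ModuleCat.ofHom (LinearMap.toSpanSingleton R _ c)) 2 (by simp) hcyc).hom (1 : R)
  have hz : K.iCycles 1 z = c := by
    have := ConcreteCategory.congr_hom (K.liftCycles_i (A := ModuleCat.of R R) (k := ModuleCat.ofHom (LinearMap.toSpanSingleton R _ c)) 2 (by simp) hcyc) (1 : R)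
    refine Eq.trans this ?_
    exact one_smul R c
  have h0 : K.homologyπ 1 (x • z) = 0 := by rw [map_smul, hH]
  have hex : (ShortComplex.mk (K.toCycles 0 1) (K.homologyπ 1) (by simp)).Exact :=
    ShortComplex.exact_of_g_is_cokernel _ (K.homologyIsCokernel 0 1 (by simp))
  obtain ⟨k, hk⟩ := (ShortComplex.moduleCat_exact_iff _).1 hex _ h0
  refine ⟨k, ?_⟩
  have := congrArg (K.iCycles 1) hk
  rw [map_smul, hz] at this
  refine Eq.trans ?_ this
  change _ = (K.toCycles 0 1 ≫ K.iCycles 1) k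
  rw [K.toCycles_i]
  rfl

lemma ext_split {R : Type} [CommRing R] {N M F : ModuleCat.{0} R} [Projective F] (ι : M ⟶ F)
    (g : F ⟶ N) (w : ι ≫ g = 0)
    (hS : (ShortComplex.mk ι g w).ShortExact) (x : R) (hann : SMulExtZero R x 1 N M) :
    ∃ h : F ⟶ M, ι ≫ h = x • 𝟙 M := by
  let P := projectiveResolution N
  have : Epi g := hS.epi_g
  have : Mono ι := hS.mono_f
  let p : P.complex.X 0 ⟶ N := P.π.f 0
  have : Epi p := inferInstanceAs (Epi (P.π.f 0))
  let a : P.complex.X 0 ⟶ F := Projective.factorThru p g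
  have ha : a ≫ g = p := Projective.factorThru_comp _ _
  let b : F ⟶ P.complex.X 0 := Projective.factorThru g p
  have hb : b ≫ p = g := Projective.factorThru_comp _ _
  have hdp : P.complex.d 1 0 ≫ p = 0 := P.complex_d_comp_π_f_zero
  let c : P.complex.X 1 ⟶ M := hS.exact.lift (P.complex.d 1 0 ≫ a) (by simp [ha, hdp])
  have hc : c ≫ ι = P.complex.d 1 0 ≫ a := hS.exact.lift_f _ _
  obtain ⟨k, hk⟩ := ext_cob P x hann c (by
    rw [← cancel_mono ι, Category.assoc, hc]; simp)
  let e : F ⟶ M := hS.exact.lift (b ≫ a - 𝟙 F) (by simp [ha, hb])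
  have he : e ≫ ι = b ≫ a - 𝟙 F := hS.exact.lift_f _ _
  refine ⟨b ≫ k - x • e, ?_⟩
  rw [← cancel_mono ι]
  ext m
  have hex := (ShortComplex.moduleCat_exact_iff _).1 P.exact₀ (b (ι m)) (by
    change (ι ≫ b ≫ p) m = 0
    rw [hb, w]; rfl)
  obtain ⟨q, hq⟩ := hex
  change P.complex.d 1 0 q = b (ι m) at hq
  have h1 : k (b (ι m)) = x • c q := by
    rw [← hq]; exact ConcreteCategory.congr_hom hk q
  have h2 : ι (c q) = a (b (ι m)) := by
    rw [← hq]; exact ConcreteCategory.congr_hom hc q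
  have h3 : ι (e (ι m)) = a (b (ι m)) - ι m := ConcreteCategory.congr_hom he (ι m)
  change ι (k (b (ι m)) - x • e (ι m)) = ι (x • m)
  rw [h1, map_sub, map_smul, map_smul, map_smul, h2, h3, smul_sub, sub_sub_cancel]

lemma main_exact {R : Type} [CommRing R] {N M : ModuleCat.{0} R} {q : ℕ}
    (ι : M →ₗ[R] (Fin q → R)) (g : (Fin q → R) →ₗ[R] N) (hg : Function.Surjective g)
    (hex : Function.Exact ι g) (x : R) (hxM : ∀ m : M, x • m = 0 → m = 0)
    (h : (Fin q → R) →ₗ[R] M) (hh : ∀ m, h (ι m) = x • m) :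
    ∃ φ : (N × M) →ₗ[R] QuotSMulTop x M, Function.Surjective φ ∧
      Function.Exact (g.prod h) φ ∧ Function.Injective (g.prod h) := by
  let mk : M →ₗ[R] QuotSMulTop x M := Submodule.mkQ _
  have hmk : ∀ m, mk m = 0 ↔ ∃ m', x • m' = m := by
    intro m
    simp [mk, Submodule.mem_smul_pointwise_iff_exists]
  have hle : LinearMap.ker g ≤ LinearMap.ker (mk ∘ₗ h) := by
    intro f hf
    obtain ⟨m, rfl⟩ := (hex f).1 hf
    simp only [LinearMap.mem_ker, LinearMap.comp_apply, hh]
    exact (hmk _).2 ⟨m, rfl⟩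
  let hb : N →ₗ[R] QuotSMulTop x M :=
    (LinearMap.ker g).liftQ (mk ∘ₗ h) hle ∘ₗ (g.quotKerEquivOfSurjective hg).symm.toLinearMap
  have hhb : ∀ f, hb (g f) = mk (h f) := by
    intro f
    have : (g.quotKerEquivOfSurjective hg).symm (g f) = (LinearMap.ker g).mkQ f := by
      rw [LinearEquiv.symm_apply_eq]; rfl
    simp [hb, this]
  refine ⟨mk ∘ₗ LinearMap.snd R N M - hb ∘ₗ LinearMap.fst R N M, ?_, ?_, ?_⟩
  · intro y
    obtain ⟨m, rfl⟩ := Submodule.mkQ_surjective _ y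
    exact ⟨(0, m), by simp [mk]⟩
  · rintro ⟨n, m⟩
    obtain ⟨f, rfl⟩ := hg n
    simp only [LinearMap.sub_apply, LinearMap.comp_apply, LinearMap.snd_apply, LinearMap.fst_apply, hhb, ← map_sub,
      hmk]
    constructor
    · rintro ⟨m', hm'⟩
      refine ⟨f + ι m', ?_⟩
      simp [hh, hex.apply_apply_eq_zero, hm']
    · rintro ⟨f', hf'⟩
      replace hf' : g f' = g f ∧ h f' = m := Prod.mk.inj hf'
      obtain ⟨m', hm'⟩ := (hex (f' - f)).1 (by simp [hf'.1])
      exact ⟨m', by rw [← hh, hm', map_sub, hf'.2]⟩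
  · rw [injective_iff_map_eq_zero]
    intro f hf
    replace hf : g f = 0 ∧ h f = 0 := Prod.mk.inj hf
    obtain ⟨m, rfl⟩ := (hex f).1 hf.1
    rw [hxM m (by rw [← hh, hf.2]), map_zero]

end TR

/-- Corollary 2.10 in the case `n = 1`: `M/xM` is Tor-rigid for `M = Ω N`
when `N` is 2-Tor-rigid and `x · Ext^1(N, Ω N) = 0`. -/
theorem quotient_of_syzygy_tor_rigid
    (R : Type) [CommRing R] [IsNoetherianRing R] [IsLocalRing R]
    (N : ModuleCat.{0} R) [Module.Finite R N]
    (hrig : NTorRigid R 2 N)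
    (x : R) (hx : RingTheory.Sequence.IsRegular R [x])
    (M : ModuleCat.{0} R) (hM : IsSyzygyOf R N M)
    (hann : SMulExtZero R x 1 N M) :
    TorRigid R (ModuleCat.of R (QuotSMulTop x ↥M)) := by
  obtain ⟨q, g, hg, -, ⟨e⟩⟩ := hM
  let ι : M →ₗ[R] (Fin q → R) := (LinearMap.ker g).subtype ∘ₗ e.toLinearMap
  have hι : Function.Injective ι := Subtype.val_injective.comp e.injective
  have hex : Function.Exact ι g := by
    intro f
    constructor
    · intro hf
      exact ⟨e.symm ⟨f, hf⟩, by simp [ι]⟩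
    · rintro ⟨m, rfl⟩
      exact (e m).2
  have hxR : IsSMulRegular R x := by
    have := hx.toIsWeaklyRegular
    simpa using this
  have hxM : ∀ m : M, x • m = 0 → m = 0 := by
    intro m hm
    apply hι
    rw [map_zero]
    have h1 : x • ι m = 0 := by rw [← map_smul, hm, map_zero]
    funext i
    apply hxR
    simpa using congrFun h1 i
  let F : ModuleCat.{0} R := ModuleCat.of R (Fin q → R)
  have hPF : Projective F := (IsProjective.iff_projective _).1 inferInstance
  have hFlat : Module.Flat R F := inferInstanceAs (Module.Flat R (Fin q → R))
  have hS1 : (ShortComplex.mk (ModuleCat.ofHom ι : M ⟶ F) (ModuleCat.ofHom g : F ⟶ N) (by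
      ext m; exact hex.apply_apply_eq_zero m)).ShortExact :=
    ModuleCat.shortComplex_shortExact _ hex hι hg
  obtain ⟨h, hh⟩ := ext_split _ _ _ hS1 x hann
  obtain ⟨φ, hφ, hφex, hinj⟩ := main_exact ι g hg hex x hxM h.hom
    (fun m => ConcreteCategory.congr_hom hh m)
  let E : ModuleCat.{0} R := ModuleCat.of R (N × M)
  have hS2 : (ShortComplex.mk (ModuleCat.ofHom (g.prod h.hom) : F ⟶ E)
      (ModuleCat.ofHom φ : E ⟶ ModuleCat.of R (QuotSMulTop x M)) (by
      apply ModuleCat.hom_ext; exact LinearMap.ext fun m => hφex.apply_apply_eq_zero m)).ShortExact :=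
    ModuleCat.shortComplex_shortExact _ hφex hinj hφ
  have hS3 : (ShortComplex.mk (ModuleCat.ofHom (LinearMap.inl R N M) : N ⟶ E)
      (ModuleCat.ofHom (LinearMap.snd R N M) : E ⟶ M) (by
      ext m; rfl)).ShortExact :=
    ModuleCat.shortComplex_shortExact _ Function.Exact.inl_snd LinearMap.inl_injective
      LinearMap.snd_surjective
  intro L hL i hi h0 j hij
  obtain ⟨i, rfl⟩ : ∃ i', i = i' + 1 := ⟨i - 1, by omega⟩
  have hE : TorZero R (i + 1) E L := tor_mid hS2 (tor_flat i F) h0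
  have hN : TorZero R (i + 1) N L :=
    tor_retract (ModuleCat.ofHom (LinearMap.inl R N M) : N ⟶ E)
      (ModuleCat.ofHom (LinearMap.fst R N M) : E ⟶ N) (by ext m; rfl) hE
  have hM : TorZero R (i + 1) M L :=
    tor_retract (ModuleCat.ofHom (LinearMap.inr R N M) : M ⟶ E)
      (ModuleCat.ofHom (LinearMap.snd R N M) : E ⟶ M) (by ext m; rfl) hE
  have hN2 : TorZero R (i + 2) N L := tor_right hS1 (tor_flat (i + 1) F) hM
  have hNall := hrig L hL i (fun k hk1 hk2 => by
    obtain rfl | rfl : k = i + 1 ∨ k = i + 2 := by omega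
    · exact hN
    · exact hN2)
  obtain rfl | hlt := hij.eq_or_lt
  · exact h0
  obtain ⟨j, rfl⟩ : ∃ j', j = j' + 2 := ⟨j - 2, by omega⟩
  have hMj : TorZero R (j + 2) M L :=
    tor_left hS1 (hNall (j + 3) (by omega)) (tor_flat (j + 1) F)
  have hEj : TorZero R (j + 2) E L := tor_mid hS3 (hNall (j + 2) (by omega)) hMj
  exact tor_right hS2 hEj (tor_flat j F)
end

section
/- Let R be a commutative Noetherian local ring, 𝔞 and 𝔟 ideals of R with depth_R(𝔞, R) ≥ 1 and depth_R(𝔟, R) ≥ 1. If R/𝔟 is 2-Tor-rigid (e.g., 𝔟 is a Burch ideal), then depth_R(𝔞, 𝔟) ≤ depth_R(𝔞, R) + 1. -/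
open CategoryTheory IsLocalRing

section Helpers
open Abelian TensorProduct

lemma char_exact {A B C : Type} [AddCommGroup A] [AddCommGroup B] [AddCommGroup C]
    (f : A →+ B) (g : B →+ C) (hgf : ∀ a, g (f a) = 0) :
    Function.Exact f g ↔ ∀ c : CharacterModule B, (∀ a, c (f a) = 0) →
      ∃ d : CharacterModule C, ∀ b, d (g b) = c b := by
  constructor
  · intro h c hc
    have hle : g.ker ≤ AddMonoidHom.ker (G := B) (M := AddCircle (1:ℚ)) c := by
      intro b hb
      obtain ⟨a, rfl⟩ := (h b).1 hb
      exact hc a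
    let gbar : (B ⧸ g.ker) →+ C := QuotientAddGroup.kerLift g
    have hinj : Function.Injective gbar := QuotientAddGroup.kerLift_injective g
    obtain ⟨d, hd⟩ := CharacterModule.dual_surjective_of_injective
      (R := ℤ) gbar.toIntLinearMap hinj (QuotientAddGroup.lift g.ker c hle)
    refine ⟨d, fun b => ?_⟩
    have := DFunLike.congr_fun hd (QuotientAddGroup.mk b)
    exact this
  · intro h b
    constructor
    · intro hb
      by_contra hne
      have : (QuotientAddGroup.mk b : B ⧸ f.range) ≠ 0 := by
        intro h0
        exact hne ((QuotientAddGroup.eq_zero_iff b).1 h0)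
      obtain ⟨c, hc⟩ := CharacterModule.exists_character_apply_ne_zero_of_ne_zero this
      obtain ⟨d, hd⟩ := h (AddMonoidHom.comp (P := AddCircle (1:ℚ)) c (QuotientAddGroup.mk' f.range))
        (fun a => by
          have : (QuotientAddGroup.mk (f a) : B ⧸ f.range) = 0 :=
            (QuotientAddGroup.eq_zero_iff _).2 ⟨a, rfl⟩
          change c (QuotientAddGroup.mk (f a)) = 0
          rw [this]; exact map_zero c)
      apply hc
      have h2 := hd b
      rw [hb] at h2
      exact h2.symm.trans (map_zero d)
    · rintro ⟨a, rfl⟩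
      exact hgf a

variable {R : Type} [CommRing R]

lemma char_hom_exact {M A B C : Type} [AddCommGroup A] [AddCommGroup B] [AddCommGroup C]
    [AddCommGroup M] [Module R M] [Module R A] [Module R B] [Module R C]
    (f : A →ₗ[R] B) (g : B →ₗ[R] C) (hgf : g ∘ₗ f = 0) :
    Function.Exact (f.lTensor M) (g.lTensor M) ↔
      ∀ c : B →ₗ[R] CharacterModule M, c ∘ₗ f = 0 →
      ∃ d : C →ₗ[R] CharacterModule M, d ∘ₗ g = c := by
  have e1 : Function.Exact (f.lTensor M) (g.lTensor M) ↔
      Function.Exact (f.rTensor M) (g.rTensor M) :=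
    (LinearMap.rTensor_exact_iff_lTensor_exact ..).symm
  rw [e1]
  have := char_exact (f.rTensor M).toAddMonoidHom (g.rTensor M).toAddMonoidHom (fun a => by
    have : g.rTensor M ∘ₗ f.rTensor M = 0 := by rw [← LinearMap.rTensor_comp, hgf]; simp
    exact LinearMap.congr_fun this a)
  refine this.trans ⟨fun h c hc => ?_, fun h c hc => ?_⟩
  · obtain ⟨d, hd⟩ := h (CharacterModule.homEquiv (R := R) c) (fun a => by
      induction a with
      | zero => simp
      | add x y hx hy => rw [map_add, map_add, hx, hy, add_zero]
      | tmul x y =>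
        have := LinearMap.congr_fun hc x
        have := DFunLike.congr_fun this y
        exact this)
    refine ⟨CharacterModule.homEquiv.symm d, ?_⟩
    ext b m
    have := hd (b ⊗ₜ m)
    exact this
  · obtain ⟨d, hd⟩ := h (CharacterModule.homEquiv (R := R).symm c) (by
      ext a m
      exact hc (a ⊗ₜ m))
    refine ⟨CharacterModule.homEquiv (R := R) d, fun b => ?_⟩
    induction b with
    | zero => simp
    | add x y hx hy => rw [map_add, map_add, map_add, hx, hy]
    | tmul x y =>
      have := LinearMap.congr_fun hd x
      have := DFunLike.congr_fun this y
      exact this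

lemma torZero_iff_s12 [IsNoetherianRing R] (n : ℕ) (M N : ModuleCat.{0} R) :
    TorZero R (n+1) M N ↔
      Subsingleton (Abelian.Ext N (ModuleCat.of R (CharacterModule M)) (n+1)) := by
  obtain ⟨P⟩ : Nonempty (ProjectiveResolution N) := HasProjectiveResolution.out
  let W := ModuleCat.of R (CharacterModule M)
  have h1 : Subsingleton (Abelian.Ext N W (n+1)) ↔
      ∀ c : P.complex.X (n+1) ⟶ W, P.complex.d (n+2) (n+1) ≫ c = 0 →
        ∃ d : P.complex.X n ⟶ W, P.complex.d (n+1) n ≫ d = c := by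
    constructor
    · intro hs c hc
      exact (P.extMk_eq_zero_iff c (n+2) rfl hc n rfl).1 (Subsingleton.elim _ _)
    · intro h
      refine subsingleton_of_forall_eq 0 fun α => ?_
      obtain ⟨f, hf, rfl⟩ := P.extMk_surjective α (n+2) rfl
      exact (P.extMk_eq_zero_iff f (n+2) rfl hf n rfl).2 (h f hf)
  rw [h1]
  let F := (MonoidalCategory.tensoringLeft (ModuleCat.{0} R)).obj M
  have h2 : TorZero R (n+1) M N ↔
      (((F.mapHomologicalComplex _).obj P.complex).ExactAt (n+1)) := by
    rw [HomologicalComplex.exactAt_iff_isZero_homology]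
    unfold TorZero
    rw [← ModuleCat.isZero_iff_subsingleton]
    exact (P.isoLeftDerivedObj F (n+1)).isZero_iff
  rw [h2, HomologicalComplex.exactAt_iff' _ (n+2) (n+1) n (by simp) (by simp),
    ShortComplex.ShortExact.moduleCat_exact_iff_function_exact]
  have := char_hom_exact (M := M) (P.complex.d (n+2) (n+1)).hom (P.complex.d (n+1) n).hom
    (by
      have := P.complex.d_comp_d (n+2) (n+1) n
      exact congrArg ModuleCat.Hom.hom this)
  refine Iff.trans (by rfl) (this.trans ?_)
  constructor
  · intro h c hc
    obtain ⟨d, hd⟩ := h c.hom (congrArg ModuleCat.Hom.hom hc)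
    exact ⟨ModuleCat.ofHom d, ModuleCat.hom_ext hd⟩
  · intro h c hc
    obtain ⟨d, hd⟩ := h (ModuleCat.ofHom c) (ModuleCat.hom_ext hc)
    exact ⟨d.hom, congrArg ModuleCat.Hom.hom hd⟩

/-- short exact sequence of modules as a short complex -/
lemma mkSES {A B C : ModuleCat.{0} R} (f : A ⟶ B) (g : B ⟶ C)
    (hf : Function.Injective f.hom) (hfg : Function.Exact f.hom g.hom)
    (hg : Function.Surjective g.hom) :
    ∃ w : f ≫ g = 0, (ShortComplex.mk f g w).ShortExact := by
  refine ⟨ModuleCat.hom_ext (hfg.linearMap_comp_eq_zero), ?_⟩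
  refine { exact := ?_, mono_f := ?_, epi_g := ?_ }
  · exact (ShortComplex.ShortExact.moduleCat_exact_iff_function_exact _).2 hfg
  · exact (ModuleCat.mono_iff_injective _).2 hf
  · exact (ModuleCat.epi_iff_surjective _).2 hg

section SES
variable {A B C : Type} [AddCommGroup A] [AddCommGroup B] [AddCommGroup C]
    [Module R A] [Module R B] [Module R C]
    (f : A →ₗ[R] B) (g : B →ₗ[R] C)

lemma ext3_of
    (hf : Function.Injective f) (hfg : Function.Exact f g) (hg : Function.Surjective g)
    (W : ModuleCat.{0} R)
    (n : ℕ) (h1 : Subsingleton (Abelian.Ext (ModuleCat.of R A) W n))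
    (h2 : Subsingleton (Abelian.Ext (ModuleCat.of R B) W (n+1))) :
    Subsingleton (Abelian.Ext (ModuleCat.of R C) W (n+1)) := by
  obtain ⟨w, hS⟩ := mkSES (ModuleCat.ofHom f) (ModuleCat.ofHom g) hf hfg hg
  refine subsingleton_of_forall_eq 0 fun x => ?_
  obtain ⟨y, rfl⟩ := Abelian.Ext.contravariant_sequence_exact₃ hS W x (h2.elim _ _) (add_comm 1 n)
  rw [show y = 0 from h1.elim _ _, Abelian.Ext.comp_zero]

lemma ext1_of
    (hf : Function.Injective f) (hfg : Function.Exact f g) (hg : Function.Surjective g)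
    (W : ModuleCat.{0} R)
    (n : ℕ) (h2 : Subsingleton (Abelian.Ext (ModuleCat.of R B) W n))
    (h3 : Subsingleton (Abelian.Ext (ModuleCat.of R C) W (n+1))) :
    Subsingleton (Abelian.Ext (ModuleCat.of R A) W n) := by
  obtain ⟨w, hS⟩ := mkSES (ModuleCat.ofHom f) (ModuleCat.ofHom g) hf hfg hg
  refine subsingleton_of_forall_eq 0 fun x => ?_
  obtain ⟨y, rfl⟩ := Abelian.Ext.contravariant_sequence_exact₁ hS W x (add_comm 1 n) (h3.elim _ _)
  rw [show y = 0 from h2.elim _ _, Abelian.Ext.comp_zero]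

lemma ext3_of_extend
    (hf : Function.Injective f) (hfg : Function.Exact f g) (hg : Function.Surjective g)
    (W : ModuleCat.{0} R)
    (h1 : ∀ u : A →ₗ[R] W, ∃ v : B →ₗ[R] W, v ∘ₗ f = u)
    (h2 : Subsingleton (Abelian.Ext (ModuleCat.of R B) W 1)) :
    Subsingleton (Abelian.Ext (ModuleCat.of R C) W 1) := by
  obtain ⟨w, hS⟩ := mkSES (ModuleCat.ofHom f) (ModuleCat.ofHom g) hf hfg hg
  refine subsingleton_of_forall_eq 0 fun x => ?_
  obtain ⟨y, rfl⟩ := Abelian.Ext.contravariant_sequence_exact₃ hS W x (h2.elim _ _) (add_comm 1 0)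
  obtain ⟨u, rfl⟩ := Abelian.Ext.addEquiv₀.symm.surjective y
  obtain ⟨v, hv⟩ := h1 u.hom
  have : u = ModuleCat.ofHom f ≫ ModuleCat.ofHom v := ModuleCat.hom_ext hv.symm
  subst this
  have h := Abelian.Ext.mk₀_comp_mk₀ (ModuleCat.ofHom f) (ModuleCat.ofHom v)
  change hS.extClass.comp (Abelian.Ext.mk₀ _) _ = 0
  rw [← h]
  exact hS.extClass_comp_assoc _

lemma extend_of_ext3
    (hf : Function.Injective f) (hfg : Function.Exact f g) (hg : Function.Surjective g)
    (W : ModuleCat.{0} R)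
    (h3 : Subsingleton (Abelian.Ext (ModuleCat.of R C) W 1))
    (u : A →ₗ[R] W) : ∃ v : B →ₗ[R] W, v ∘ₗ f = u := by
  obtain ⟨w, hS⟩ := mkSES (ModuleCat.ofHom f) (ModuleCat.ofHom g) hf hfg hg
  obtain ⟨y, hy⟩ := Abelian.Ext.contravariant_sequence_exact₁ hS W
    (Abelian.Ext.mk₀ (ModuleCat.ofHom u)) (add_comm 1 0) (h3.elim _ _)
  obtain ⟨v, rfl⟩ := Abelian.Ext.addEquiv₀.symm.surjective y
  refine ⟨v.hom, ?_⟩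
  have h := Abelian.Ext.mk₀_comp_mk₀ (ModuleCat.ofHom f) v
  have h2 : Abelian.Ext.mk₀ (ModuleCat.ofHom f ≫ v) = Abelian.Ext.mk₀ (ModuleCat.ofHom u) :=
    h.symm.trans hy
  have h3 := Abelian.Ext.addEquiv₀.symm.injective h2
  exact congrArg ModuleCat.Hom.hom h3

/-- covariant version -/
lemma extcov3_of
    (hf : Function.Injective f) (hfg : Function.Exact f g) (hg : Function.Surjective g)
    (W : ModuleCat.{0} R)
    (n : ℕ) (h2 : Subsingleton (Abelian.Ext W (ModuleCat.of R B) n))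
    (h1 : Subsingleton (Abelian.Ext W (ModuleCat.of R A) (n+1))) :
    Subsingleton (Abelian.Ext W (ModuleCat.of R C) n) := by
  obtain ⟨w, hS⟩ := mkSES (ModuleCat.ofHom f) (ModuleCat.ofHom g) hf hfg hg
  refine subsingleton_of_forall_eq 0 fun x => ?_
  obtain ⟨y, rfl⟩ := Abelian.Ext.covariant_sequence_exact₃ W hS x rfl (h1.elim _ _)
  rw [show y = 0 from h2.elim _ _, Abelian.Ext.zero_comp]

end SES

/-- maps to the character module of `R/b` extend along maps injective modulo `b`. -/
lemma extend_char_iff (b : Ideal R) {A B : Type} [AddCommGroup A] [AddCommGroup B]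
    [Module R A] [Module R B] (f : A →ₗ[R] B) :
    (∀ u : A →ₗ[R] CharacterModule (R ⧸ b), ∃ v : B →ₗ[R] CharacterModule (R ⧸ b), v ∘ₗ f = u) ↔
    ∀ x, f x ∈ b • (⊤ : Submodule R B) → x ∈ b • (⊤ : Submodule R A) := by
  have h0 : (∀ u : A →ₗ[R] CharacterModule (R ⧸ b),
      ∃ v : B →ₗ[R] CharacterModule (R ⧸ b), v ∘ₗ f = u) ↔
      Function.Injective (f.rTensor (R ⧸ b)) :=
    (rTensor_injective_iff_lcomp_surjective (R := R) (B := R ⧸ b) (f := f)).symm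
  rw [h0]
  let eA := TensorProduct.tensorQuotEquivQuotSMul A b
  let eB := TensorProduct.tensorQuotEquivQuotSMul B b
  have vA : ∀ x : A, eA (x ⊗ₜ[R] (1 : R ⧸ b)) = Submodule.Quotient.mk x := fun x =>
    (LinearEquiv.apply_symm_apply eA (Submodule.Quotient.mk x))
  have vB : ∀ x : B, eB (x ⊗ₜ[R] (1 : R ⧸ b)) = Submodule.Quotient.mk x := fun x =>
    (LinearEquiv.apply_symm_apply eB (Submodule.Quotient.mk x))
  have hsurj : ∀ z : A ⊗[R] (R ⧸ b), ∃ x : A, x ⊗ₜ (1 : R ⧸ b) = z := by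
    intro z
    obtain ⟨x, hx⟩ := Submodule.Quotient.mk_surjective _ (eA z)
    refine ⟨x, eA.injective ?_⟩
    rw [← hx]
    exact vA x
  have hA : ∀ x : A, x ⊗ₜ[R] (1 : R ⧸ b) = 0 ↔ x ∈ b • (⊤ : Submodule R A) := by
    intro x
    rw [← eA.map_eq_zero_iff]
    rw [vA, Submodule.Quotient.mk_eq_zero]
  have hB : ∀ x : B, x ⊗ₜ[R] (1 : R ⧸ b) = 0 ↔ x ∈ b • (⊤ : Submodule R B) := by
    intro x
    rw [← eB.map_eq_zero_iff]
    rw [vB, Submodule.Quotient.mk_eq_zero]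
  rw [injective_iff_map_eq_zero]
  constructor
  · intro h x hx
    exact (hA x).1 (h _ (by rw [LinearMap.rTensor_tmul]; exact (hB _).2 hx))
  · intro h z hz
    obtain ⟨x, rfl⟩ := hsurj z
    rw [LinearMap.rTensor_tmul, hB] at hz
    exact (hA x).2 (h x hz)

/-- consequences of `Ext^0(R/a, B) = 0`. -/
lemma eq_zero_of_ext0 (a : Ideal R) {B : Type} [AddCommGroup B] [Module R B]
    (h : Subsingleton (Abelian.Ext (ModuleCat.of R (R ⧸ a)) (ModuleCat.of R B) 0))
    (e : B) (he : ∀ s ∈ a, s • e = 0) : e = 0 := by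
  have h1 : Subsingleton (ModuleCat.of R (R ⧸ a) ⟶ ModuleCat.of R B) :=
    Abelian.Ext.addEquiv₀.subsingleton_congr.mp h
  let φ : (R ⧸ a) →ₗ[R] B := Submodule.liftQ a (LinearMap.toSpanSingleton R B e)
    (fun s hs => by simpa using he s hs)
  have h2 : ModuleCat.ofHom φ = ModuleCat.ofHom (0 : (R ⧸ a) →ₗ[R] B) := h1.elim _ _
  have h3 : φ = 0 := congrArg ModuleCat.Hom.hom h2
  have h4 := LinearMap.congr_fun h3 (Submodule.Quotient.mk 1)
  have h5 : φ (Submodule.Quotient.mk 1) = (1 : R) • e := rfl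
  rw [h5, one_smul] at h4
  exact h4

lemma exists_of_ext1 (a : Ideal R) {B : Type} [AddCommGroup B] [Module R B]
    (h : Subsingleton (Abelian.Ext (ModuleCat.of R (R ⧸ a)) (ModuleCat.of R B) 1))
    (u : a →ₗ[R] B) : ∃ e : B, ∀ s : a, u s = (s : R) • e := by
  obtain ⟨v, hv⟩ := extend_of_ext3 (Submodule.subtype a) (Submodule.mkQ a)
    (Submodule.subtype_injective a) (LinearMap.exact_subtype_mkQ a) (Submodule.mkQ_surjective a)
    (ModuleCat.of R B) h u
  refine ⟨v 1, fun s => ?_⟩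
  rw [← hv]
  change v (s : R) = _
  rw [← map_smul, smul_eq_mul, mul_one]

/-- If `a r ⊆ bA` then `r = z + e` with `a z = 0` and `e ∈ bA`. -/
lemma exists_decomp (a b : Ideal R) {A : Type} [AddCommGroup A] [Module R A]
    (h : Subsingleton (Abelian.Ext (ModuleCat.of R (R ⧸ a))
      (ModuleCat.of R (b • ⊤ : Submodule R A)) 1))
    (r : A) (hr : ∀ s ∈ a, s • r ∈ (b • ⊤ : Submodule R A)) :
    ∃ e ∈ (b • ⊤ : Submodule R A), ∀ s ∈ a, s • (r - e) = 0 := by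
  let u : a →ₗ[R] (b • ⊤ : Submodule R A) :=
    LinearMap.codRestrict _ ((LinearMap.toSpanSingleton R A r) ∘ₗ a.subtype)
      (fun s => by simpa using hr s s.2)
  obtain ⟨e, he⟩ := exists_of_ext1 a h u
  refine ⟨e, e.2, fun s hs => ?_⟩
  have := congrArg Subtype.val (he ⟨s, hs⟩)
  rw [smul_sub, sub_eq_zero]
  simpa [u] using this

/-- `Tor_1(Z, R/b) ≠ 0` when `bZ = 0`, `Z ≠ 0` finite, `b ≠ 0`. -/
lemma not_ext1_of_smul_eq_bot [IsLocalRing R] [IsNoetherianRing R] (b : Ideal R) (hb : b ≠ ⊥)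
    {Z : Type} [AddCommGroup Z] [Module R Z] [Module.Finite R Z] [Nontrivial Z]
    (hbZ : ∀ s ∈ b, ∀ z : Z, s • z = 0)
    (h : Subsingleton (Abelian.Ext (ModuleCat.of R Z)
      (ModuleCat.of R (CharacterModule (R ⧸ b))) 1)) : False := by
  obtain ⟨q, π, hπ⟩ := Module.Finite.exists_fin' R Z
  let P := Fin q → R
  let K := LinearMap.ker π
  have hext := extend_of_ext3 K.subtype π K.subtype_injective
    (LinearMap.exact_subtype_ker_map π) hπ _ h
  have hK := (extend_char_iff b K.subtype).1 hext
  -- surjection to the residue field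
  obtain ⟨H, hH, -⟩ := (eq_top_or_exists_le_coatom (⊥ : Submodule R Z)).resolve_left bot_ne_top
  have hsimple : IsSimpleModule R (Z ⧸ H) := isSimpleModule_iff_isCoatom.2 hH
  obtain ⟨I, hI, ⟨ε⟩⟩ := isSimpleModule_iff_quot_maximal.1 hsimple
  obtain rfl : I = maximalIdeal R := IsLocalRing.eq_maximalIdeal hI
  let l : P →ₗ[R] (R ⧸ maximalIdeal R) := ε.toLinearMap ∘ₗ H.mkQ ∘ₗ π
  have hl : Function.Surjective l :=
    ε.surjective.comp ((Submodule.mkQ_surjective H).comp hπ)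
  obtain ⟨lam, hlam⟩ := Module.projective_lifting_property (maximalIdeal R).mkQ l
    (Submodule.mkQ_surjective _)
  obtain ⟨p, hp⟩ := hl (Submodule.Quotient.mk 1)
  have hlp : IsUnit (lam p) := by
    by_contra hnu
    have h1 : (maximalIdeal R).mkQ (lam p) = 0 :=
      (Submodule.Quotient.mk_eq_zero _).2 ((mem_maximalIdeal _).2 hnu)
    have h2 : (maximalIdeal R).mkQ (lam p) = l p := LinearMap.congr_fun hlam p
    rw [h1, hp] at h2
    have h3 := (Submodule.Quotient.mk_eq_zero _).1 h2.symm
    exact (Ideal.ne_top_iff_one _).1 (maximalIdeal.isMaximal R).ne_top h3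
  have hKm : ∀ k : K, lam k ∈ maximalIdeal R := by
    intro k
    have h2 : (maximalIdeal R).mkQ (lam k) = l k := LinearMap.congr_fun hlam k
    have h3 : π (k : P) = 0 := k.2
    have h4 : l (k : P) = 0 := by simp [l, h3]
    rw [h4] at h2
    exact (Submodule.Quotient.mk_eq_zero _).1 h2
  have hle : b ≤ maximalIdeal R • b := by
    intro s hs
    have hk : s • p ∈ K := by
      rw [LinearMap.mem_ker, map_smul]; exact hbZ s hs _
    have h1 : (⟨s • p, hk⟩ : K) ∈ b • (⊤ : Submodule R K) :=
      hK ⟨s • p, hk⟩ (Submodule.smul_mem_smul hs trivial)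
    have h2 : lam (s • p) ∈ maximalIdeal R • b := by
      have h3 := Submodule.mem_map_of_mem (f := lam ∘ₗ K.subtype) h1
      rw [Submodule.map_smul''] at h3
      have h4 : Submodule.map (lam ∘ₗ K.subtype) ⊤ ≤ maximalIdeal R := by
        rintro _ ⟨k, -, rfl⟩
        exact hKm k
      have h5 := Submodule.smul_mono (le_refl b) h4 h3
      rw [smul_eq_mul, mul_comm] at h5
      exact h5
    simp only [map_smul, smul_eq_mul] at h2
    obtain ⟨v, hv⟩ := hlp
    rw [← hv] at h2
    have := Ideal.mul_mem_right (↑v⁻¹ : R) _ h2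
    rw [mul_assoc, Units.mul_inv, mul_one] at this
    exact this
  exact hb (Submodule.eq_bot_of_le_smul_of_le_jacobson_bot (maximalIdeal R) b
    (IsNoetherian.noetherian b) hle (by rw [IsLocalRing.jacobson_eq_maximalIdeal _ bot_ne_top]))

lemma ext_pi_subsingleton {m : ℕ} (A : Type) [AddCommGroup A] [Module R A] (W : ModuleCat.{0} R)
    (i : ℕ) (h : Subsingleton (Abelian.Ext (ModuleCat.of R A) W (i + 1))) :
    Subsingleton (Abelian.Ext (ModuleCat.of R (Fin m → A)) W (i + 1)) := by
  induction m with
  | zero =>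
    have : Limits.IsZero (ModuleCat.of R (Fin 0 → A)) :=
      ModuleCat.isZero_of_subsingleton _
    refine subsingleton_of_forall_eq 0 fun x => ?_
    rw [← Abelian.Ext.mk₀_id_comp x, this.eq_of_src (𝟙 _) 0, Abelian.Ext.mk₀_zero,
      Abelian.Ext.zero_comp]
  | succ m ih =>
    let f : A →ₗ[R] (Fin (m+1) → A) := LinearMap.single R (fun _ => A) 0
    let g : (Fin (m+1) → A) →ₗ[R] (Fin m → A) := LinearMap.funLeft R A Fin.succ
    have hinj : Function.Injective f := Pi.single_injective (M := fun _ => A) (0 : Fin (m+1))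
    have hex : Function.Exact f g := by
      intro x
      constructor
      · intro hx
        refine ⟨x 0, ?_⟩
        funext j
        refine Fin.cases ?_ (fun j => ?_) j
        · simp [f]
        · have h2 : x j.succ = 0 := congrFun hx j
          simp [f, h2]
      · rintro ⟨y, rfl⟩
        funext j
        simp [f, g, LinearMap.funLeft]
    have hS := mkSES (R := R) (ModuleCat.ofHom f) (ModuleCat.ofHom g) hinj hex
      (LinearMap.funLeft_surjective_of_injective R A _ (Fin.succ_injective m))
    obtain ⟨w, hS⟩ := hS
    refine subsingleton_of_forall_eq 0 fun x => ?_
    obtain ⟨y, rfl⟩ := Abelian.Ext.contravariant_sequence_exact₂ hS W x (h.elim _ _)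
    rw [show y = 0 from ih.elim _ _, Abelian.Ext.comp_zero]

lemma mem_smul_top_pi (b : Ideal R) {m : ℕ} {A : Type} [AddCommGroup A] [Module R A]
    (x : Fin m → A) (hx : x ∈ (b • ⊤ : Submodule R (Fin m → A))) (j : Fin m) :
    x j ∈ (b • ⊤ : Submodule R A) := by
  have := Submodule.mem_map_of_mem (f := LinearMap.proj (R := R) (φ := fun _ : Fin m => A) j) hx
  rw [Submodule.map_smul''] at this
  exact Submodule.smul_mono le_rfl le_top this

/-- The case where `0 :_A a ≠ 0`. -/
lemma key_base [IsLocalRing R] [IsNoetherianRing R] (a b : Ideal R) (hb : b ≠ ⊥)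
    (hrig : NTorRigid R 2 (ModuleCat.of R (R ⧸ b)))
    (A : Type) [AddCommGroup A] [Module R A] [Module.Finite R A]
    (hac : ∀ i, Subsingleton (Abelian.Ext (ModuleCat.of R A)
      (ModuleCat.of R (CharacterModule (R ⧸ b))) (i + 1)))
    (h0 : Subsingleton (Abelian.Ext (ModuleCat.of R (R ⧸ a))
      (ModuleCat.of R (b • ⊤ : Submodule R A)) 0))
    (h1 : Subsingleton (Abelian.Ext (ModuleCat.of R (R ⧸ a))
      (ModuleCat.of R (b • ⊤ : Submodule R A)) 1))
    (hZ : ∃ z : A, z ≠ 0 ∧ ∀ s ∈ a, s • z = 0) : False := by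
  let W := ModuleCat.of R (CharacterModule (R ⧸ b))
  obtain ⟨m, c, hc⟩ := Submodule.fg_iff_exists_fin_generating_family.1 (IsNoetherian.noetherian a)
  have hca : ∀ j, c j ∈ a := fun j => hc ▸ Submodule.subset_span ⟨j, rfl⟩
  let φ : A →ₗ[R] (Fin m → A) := LinearMap.pi fun j => LinearMap.lsmul R A (c j)
  have hφ : ∀ x j, φ x j = c j • x := fun x j => rfl
  have hspan : ∀ (N : Submodule R A) (x : A), (∀ j, c j • x ∈ N) → ∀ s ∈ a, s • x ∈ N := by
    intro N x hx s hs
    rw [← hc] at hs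
    induction hs using Submodule.span_induction with
    | mem y hy => obtain ⟨j, rfl⟩ := hy; exact hx j
    | zero => simp
    | add y z _ _ hy hz => rw [add_smul]; exact N.add_mem hy hz
    | smul r y _ hy => rw [smul_assoc]; exact N.smul_mem r hy
  let Z := LinearMap.ker φ
  have hmemZ : ∀ x, x ∈ Z ↔ ∀ s ∈ a, s • x = 0 := by
    intro x
    constructor
    · intro hx s hs
      have := hspan ⊥ x (fun j => by
        have := congrFun (LinearMap.mem_ker.1 hx) j
        exact this) s hs
      simpa using this
    · intro hx
      rw [LinearMap.mem_ker]
      funext j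
      exact hx _ (hca j)
  let I := LinearMap.range φ
  let C := (Fin m → A) ⧸ I
  have hZb : ∀ x ∈ Z, x ∈ (b • ⊤ : Submodule R A) → x = 0 := by
    intro x hx hxb
    have := eq_zero_of_ext0 a h0 ⟨x, hxb⟩ (fun s hs => Subtype.ext ((hmemZ x).1 hx s hs))
    exact congrArg Subtype.val this
  have hpi : ∀ i, Subsingleton (Abelian.Ext (ModuleCat.of R (Fin m → A)) W (i + 1)) :=
    fun i => ext_pi_subsingleton A W i (hac i)
  have hex1 : Function.Exact I.subtype I.mkQ := LinearMap.exact_subtype_mkQ I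
  have hex2 : Function.Exact Z.subtype φ.rangeRestrict := by
    intro x
    constructor
    · intro hx
      exact ⟨⟨x, LinearMap.mem_ker.2 (congrArg Subtype.val hx)⟩, rfl⟩
    · rintro ⟨y, rfl⟩
      exact Subtype.ext (LinearMap.mem_ker.1 y.2)
  have hC1 : Subsingleton (Abelian.Ext (ModuleCat.of R C) W 1) := by
    refine ext3_of_extend I.subtype I.mkQ I.subtype_injective hex1 I.mkQ_surjective W ?_ (hpi 0)
    refine (extend_char_iff b I.subtype).2 ?_
    rintro ⟨_, r, rfl⟩ hx
    have hr : ∀ s ∈ a, s • r ∈ (b • ⊤ : Submodule R A) :=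
      hspan _ r (fun j => mem_smul_top_pi b _ hx j)
    obtain ⟨e, he, hre⟩ := exists_decomp a b h1 r hr
    have h2 : φ (r - e) = 0 := LinearMap.mem_ker.1 ((hmemZ _).2 hre)
    rw [map_sub, sub_eq_zero] at h2
    have h3 := Submodule.mem_map_of_mem (f := φ.rangeRestrict) he
    rw [Submodule.map_smul''] at h3
    have h4 : (⟨φ r, ⟨r, rfl⟩⟩ : I) = φ.rangeRestrict e := Subtype.ext h2
    rw [h4]
    exact Submodule.smul_mono le_rfl le_top h3
  have hI1 : Subsingleton (Abelian.Ext (ModuleCat.of R I) W 1) := by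
    refine ext3_of_extend Z.subtype φ.rangeRestrict Z.subtype_injective hex2
      φ.surjective_rangeRestrict W ?_ (hac 0)
    refine (extend_char_iff b Z.subtype).2 ?_
    intro x hx
    have : x = 0 := Subtype.ext (hZb x x.2 hx)
    rw [this]; exact zero_mem _
  have hC2 : Subsingleton (Abelian.Ext (ModuleCat.of R C) W 2) :=
    ext3_of I.subtype I.mkQ I.subtype_injective hex1 I.mkQ_surjective W 1 hI1 (hpi 1)
  have hC3 : Subsingleton (Abelian.Ext (ModuleCat.of R C) W 3) := by
    refine (torZero_iff_s12 2 (ModuleCat.of R (R ⧸ b)) (ModuleCat.of R C)).1 ?_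
    refine hrig (ModuleCat.of R C) (inferInstanceAs (Module.Finite R C)) 0 ?_ 3 (by norm_num)
    intro i hi hi'
    obtain rfl | rfl : i = 1 ∨ i = 2 := by omega
    · exact (torZero_iff_s12 0 (ModuleCat.of R (R ⧸ b)) (ModuleCat.of R C)).2 hC1
    · exact (torZero_iff_s12 1 (ModuleCat.of R (R ⧸ b)) (ModuleCat.of R C)).2 hC2
  have hI2 : Subsingleton (Abelian.Ext (ModuleCat.of R I) W 2) :=
    ext1_of I.subtype I.mkQ I.subtype_injective hex1 I.mkQ_surjective W 2 (hpi 1) hC3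
  have hZ1 : Subsingleton (Abelian.Ext (ModuleCat.of R Z) W 1) :=
    ext1_of Z.subtype φ.rangeRestrict Z.subtype_injective hex2
      φ.surjective_rangeRestrict W 1 (hac 0) hI2
  obtain ⟨z, hz0, hz⟩ := hZ
  have : Nontrivial Z := ⟨⟨z, (hmemZ z).2 hz⟩, 0, fun h => hz0 (congrArg Subtype.val h)⟩
  refine not_ext1_of_smul_eq_bot b hb (Z := Z) ?_ hZ1
  intro s hs y
  refine Subtype.ext (hZb _ (s • y).2 ?_)
  exact Submodule.smul_mem_smul hs trivial

open RingTheory.Sequence Pointwise in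
lemma key [IsLocalRing R] [IsNoetherianRing R] (a b : Ideal R) (hb : b ≠ ⊥)
    (hrig : NTorRigid R 2 (ModuleCat.of R (R ⧸ b))) (n : ℕ) :
    ∀ (A : Type) [AddCommGroup A] [Module R A] [Module.Finite R A]
    (_ : ∀ i, Subsingleton (Abelian.Ext (ModuleCat.of R A)
      (ModuleCat.of R (CharacterModule (R ⧸ b))) (i + 1)))
    (_ : ∀ i < n + 2, Subsingleton (Abelian.Ext (ModuleCat.of R (R ⧸ a))
      (ModuleCat.of R (b • ⊤ : Submodule R A)) i))
    (_ : ∀ rs : List R, (∀ r ∈ rs, r ∈ a) → IsWeaklyRegular A rs → rs.length ≤ n), False := by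
  induction n with
  | zero =>
    intro A _ _ _ hac hB hA
    refine key_base a b hb hrig A hac (hB 0 (by omega)) (hB 1 (by omega)) ?_
    by_contra hZ
    push Not at hZ
    have : Subsingleton ((R ⧸ a) →ₗ[R] A) := by
      refine subsingleton_of_forall_eq 0 fun f => ?_
      have h1 : f (Submodule.Quotient.mk 1) = 0 := by
        by_contra hne
        obtain ⟨s, hs, hs'⟩ := hZ _ hne
        apply hs'
        rw [← map_smul, ← Submodule.Quotient.mk_smul, smul_eq_mul, mul_one,
          (Submodule.Quotient.mk_eq_zero a).2 hs, map_zero]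
      refine LinearMap.ext fun x => ?_
      obtain ⟨x, rfl⟩ := Submodule.Quotient.mk_surjective _ x
      have : (Submodule.Quotient.mk x : R ⧸ a) = x • Submodule.Quotient.mk 1 := by
        rw [← Submodule.Quotient.mk_smul, smul_eq_mul, mul_one]
      rw [this, map_smul, h1, smul_zero, LinearMap.zero_apply]
    obtain ⟨x, hx, hreg⟩ := IsSMulRegular.subsingleton_linearMap_iff.1 this
    rw [Ideal.annihilator_quotient] at hx
    have := hA [x] (by simpa using hx) ((isWeaklyRegular_singleton_iff _ _).2 hreg)
    simp at this
  | succ n ih =>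
    intro A _ _ _ hac hB hA
    by_cases hZ : ∃ z : A, z ≠ 0 ∧ ∀ s ∈ a, s • z = 0
    · exact key_base a b hb hrig A hac (hB 0 (by omega)) (hB 1 (by omega)) hZ
    push Not at hZ
    let Q := A ⧸ (b • ⊤ : Submodule R A)
    have hsub : Subsingleton ((R ⧸ a) →ₗ[R] (A × Q)) := by
      refine subsingleton_of_forall_eq 0 fun f => ?_
      have hann : ∀ s ∈ a, s • f (Submodule.Quotient.mk 1) = 0 := by
        intro s hs
        rw [← map_smul, ← Submodule.Quotient.mk_smul, smul_eq_mul, mul_one,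
          (Submodule.Quotient.mk_eq_zero a).2 hs, map_zero]
      have h1 : f (Submodule.Quotient.mk 1) = 0 := by
        refine Prod.ext ?_ ?_
        · by_contra hne
          obtain ⟨s, hs, hs'⟩ := hZ _ hne
          exact hs' (congrArg Prod.fst (hann s hs))
        · obtain ⟨r, hr⟩ := Submodule.Quotient.mk_surjective _ (f (Submodule.Quotient.mk 1)).2
          have hr' : ∀ s ∈ a, s • r ∈ (b • ⊤ : Submodule R A) := by
            intro s hs
            rw [← Submodule.Quotient.mk_eq_zero, Submodule.Quotient.mk_smul, hr]
            exact congrArg Prod.snd (hann s hs)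
          obtain ⟨e, he, hre⟩ := exists_decomp a b (hB 1 (by omega)) r hr'
          have h3 : r - e = 0 := by
            by_contra hne
            obtain ⟨s, hs, hs'⟩ := hZ _ hne
            exact hs' (hre s hs)
          rw [sub_eq_zero] at h3
          rw [← hr, h3]
          exact (Submodule.Quotient.mk_eq_zero _).2 he
      refine LinearMap.ext fun x => ?_
      obtain ⟨x, rfl⟩ := Submodule.Quotient.mk_surjective _ x
      have : (Submodule.Quotient.mk x : R ⧸ a) = x • Submodule.Quotient.mk 1 := by
        rw [← Submodule.Quotient.mk_smul, smul_eq_mul, mul_one]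
      rw [this, map_smul, h1, smul_zero, LinearMap.zero_apply]
    obtain ⟨x, hx, hreg⟩ := IsSMulRegular.subsingleton_linearMap_iff.1 hsub
    rw [Ideal.annihilator_quotient] at hx
    have hxA : ∀ r : A, x • r = 0 → r = 0 := by
      intro r hr
      have h1 : x • ((r, 0) : A × Q) = x • 0 := by simp [hr]
      exact congrArg Prod.fst (hreg h1)
    have hxA' : IsSMulRegular A x := by
      intro r s hrs
      have hrs' : x • r = x • s := hrs
      rw [← sub_eq_zero]
      exact hxA _ (by rw [smul_sub, hrs', sub_self])
    have hxQ : ∀ r : A, x • r ∈ (b • ⊤ : Submodule R A) → r ∈ (b • ⊤ : Submodule R A) := by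
      intro r hr
      have h1 : x • ((0, Submodule.Quotient.mk r) : A × Q) = x • 0 := by
        refine Prod.ext (by simp) ?_
        simp only [Prod.smul_mk, ← Submodule.Quotient.mk_smul, smul_zero]
        exact (Submodule.Quotient.mk_eq_zero _).2 hr
      exact (Submodule.Quotient.mk_eq_zero _).1 (congrArg Prod.snd (hreg h1))
    let A' := QuotSMulTop x A
    let pr : A →ₗ[R] A' := Submodule.mkQ (x • ⊤ : Submodule R A)
    have hpr : ∀ r, pr r = 0 ↔ ∃ y, x • y = r := by
      intro r
      refine (Submodule.Quotient.mk_eq_zero _).trans ?_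
      rw [Submodule.mem_smul_pointwise_iff_exists]
      simp
    have hprs : Function.Surjective pr := Submodule.mkQ_surjective _
    refine ih A' ?_ ?_ ?_
    · have hinj : Function.Injective (LinearMap.lsmul R A x) := hxA'
      have hex : Function.Exact (LinearMap.lsmul R A x) pr := by
        intro r
        rw [hpr]
        rfl
      intro i
      match i with
      | 0 =>
        refine ext3_of_extend (LinearMap.lsmul R A x) pr hinj hex hprs _ ?_ (hac 0)
        exact (extend_char_iff b (LinearMap.lsmul R A x)).2 hxQ
      | i + 1 =>
        exact ext3_of (LinearMap.lsmul R A x) pr hinj hex hprs _ (i+1) (hac i) (hac (i+1))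
    · intro i hi
      let B : Submodule R A := b • ⊤
      let B' : Submodule R A' := b • ⊤
      have hmap : Submodule.map pr B = B' := by
        rw [Submodule.map_smul'', Submodule.map_top, LinearMap.range_eq_top.2 hprs]
      let g : B →ₗ[R] B' := pr.restrict (fun r hr => hmap ▸ Submodule.mem_map_of_mem hr)
      refine extcov3_of (LinearMap.lsmul R B x) g ?_ ?_ ?_ (ModuleCat.of R (R ⧸ a)) i
        (hB i (by omega)) (hB (i+1) (by omega))
      · intro r s hrs
        exact Subtype.ext (hxA' (congrArg Subtype.val hrs))
      · intro r
        constructor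
        · intro hr
          obtain ⟨y, hy⟩ := (hpr r).1 (congrArg Subtype.val hr)
          exact ⟨⟨y, hxQ y (by rw [hy]; exact r.2)⟩, Subtype.ext hy⟩
        · rintro ⟨y, rfl⟩
          exact Subtype.ext ((hpr _).2 ⟨y, rfl⟩)
      · rintro ⟨y, hy⟩
        obtain ⟨r, hr, hry⟩ := hmap.symm ▸ hy
        exact ⟨⟨r, hr⟩, Subtype.ext hry⟩
    · intro rs hrs hreg'
      have := hA (x :: rs) (by simpa using ⟨hx, hrs⟩)
        ((isWeaklyRegular_cons_iff A x rs).2 ⟨hxA', hreg'⟩)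
      simpa using this

end Helpers



/-- the depth inequality for (Burch-type) ideals `𝔟` with `R/𝔟` 2-Tor-rigid. -/
theorem depth_ideal_le_of_two_tor_rigid_quotient
    (R : Type) [CommRing R] [IsNoetherianRing R] [IsLocalRing R]
    (𝔞 𝔟 : Ideal R)
    (h𝔞 : 1 ≤ edepth R 𝔞 R) (h𝔟 : 1 ≤ edepth R 𝔟 R)
    (hrig : NTorRigid R 2 (ModuleCat.of R (R ⧸ 𝔟))) :
    edepth R 𝔞 (↥𝔟) ≤ edepth R 𝔞 R + 1 := by
  classical
  by_cases ha : 𝔞 • (⊤ : Submodule R R) = ⊤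
  · have h1 : edepth R 𝔞 R = ⊤ := by rw [edepth, if_pos ha]
    rw [h1, top_add]
    exact le_top
  have hat : 𝔞 ≠ ⊤ := by
    rintro rfl
    exact ha (by simp)
  have ham : 𝔞 ≤ maximalIdeal R := IsLocalRing.le_maximalIdeal hat
  have hb : 𝔟 ≠ ⊥ := by
    rintro rfl
    have hne : ((⊥ : Ideal R) • (⊤ : Submodule R R)) ≠ ⊤ := by
      rw [Submodule.bot_smul]
      exact bot_ne_top
    rw [edepth, if_neg hne] at h𝔟
    have h0 : (0 : ℕ∞) < sSup _ := lt_of_lt_of_le zero_lt_one h𝔟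
    obtain ⟨_, ⟨rs, rfl, hmem, hreg⟩, hlen⟩ := lt_sSup_iff.1 h0
    cases rs with
    | nil => simp at hlen
    | cons r rs =>
      have hr : r = 0 := by simpa using hmem r (by simp)
      subst hr
      have h2 := ((RingTheory.Sequence.isRegular_cons_iff R 0 rs).1 hreg).1
      exact one_ne_zero (h2 (show (0 : R) • (1 : R) = (0 : R) • (0 : R) by simp))
  have hbn : 𝔞 • (⊤ : Submodule R 𝔟) ≠ ⊤ := by
    intro h
    have h2 : (⊤ : Submodule R 𝔟) = ⊥ := by
      refine Submodule.eq_bot_of_le_smul_of_le_jacobson_bot 𝔞 ⊤ (IsNoetherian.noetherian _) h.ge ?_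
      rw [IsLocalRing.jacobson_eq_maximalIdeal ⊥ bot_ne_top]
      exact ham
    apply hb
    rw [eq_bot_iff]
    intro x hx
    have h3 : (⟨x, hx⟩ : 𝔟) ∈ (⊥ : Submodule R 𝔟) := h2 ▸ Submodule.mem_top
    simpa using h3
  by_contra hcon
  rw [not_le] at hcon
  obtain ⟨n, hn⟩ : ∃ n : ℕ, edepth R 𝔞 R = n := by
    refine (ENat.ne_top_iff_exists.1 ?_).imp fun _ h => h.symm
    intro h
    rw [h, top_add] at hcon
    exact not_top_lt hcon
  rw [hn, show edepth R 𝔞 𝔟 = sSup _ by rw [edepth, if_neg hbn]] at hcon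
  obtain ⟨_, ⟨rs, rfl, hmem, hreg⟩, hlen⟩ := lt_sSup_iff.1 hcon
  have hlen2 : n + 1 < rs.length := by exact_mod_cast hlen
  have hext := ModuleCat.subsingleton_ext_of_exists_isRegular 𝔞 (ModuleCat.of R (R ⧸ 𝔞))
    (by
      change Module.support R (R ⧸ 𝔞) ⊆ _
      rw [Module.support_eq_zeroLocus, Ideal.annihilator_quotient])
    (ModuleCat.of R 𝔟) (lt_top_iff_ne_top.2 hbn) rs hmem hreg
  refine key 𝔞 𝔟 hb hrig n R (fun i => ?_) (fun i hi => ?_) (fun ss hss hreg2 => ?_)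
  · have : Projective (ModuleCat.of R R) := ModuleCat.projective_of_free (Module.Basis.singleton Unit R)
    exact Abelian.Ext.subsingleton_of_projective _ _ _
  · have e : (𝔟 • ⊤ : Submodule R R) = 𝔟 := by simp
    rw [e]
    exact hext i (by omega)
  · have hreg3 := (IsLocalRing.isRegular_iff_isWeaklyRegular_of_subset_maximalIdeal
      (fun r hr => ham (hss r hr))).2 hreg2
    have h4 : (ss.length : ℕ∞) ≤ edepth R 𝔞 R := by
      rw [edepth, if_neg ha]
      exact le_sSup ⟨ss, rfl, hss, hreg3⟩
    rw [hn] at h4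
    exact_mod_cast h4
end

section
/- Let R be a commutative Noetherian local ring, N a finitely generated R-module, and n ≥ 1. If Ext_R^i(N, R) = 0 for all i = 1,…,n, then Ω_R^n Tr Ω_R^n N is stably isomorphic to Tr N; in particular Tr N is an n-th syzygy module. -/
open CategoryTheory IsLocalRing

theorem extZero_iff {R : Type} [CommRing R] {X : ModuleCat.{0} R} (P : ProjectiveResolution X)
    (Y : ModuleCat.{0} R) (n : ℕ) :
    ExtZero R (n+1) X Y ↔ ∀ φ : P.complex.X (n+1) ⟶ Y, P.complex.d (n+2) (n+1) ≫ φ = 0 →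
      ∃ ψ : P.complex.X n ⟶ Y, P.complex.d (n+1) n ≫ ψ = φ := by
  have h1 : ExtZero R (n+1) X Y ↔ (P.complex.linearYonedaObj R Y).ExactAt (n+1) := by
    rw [HomologicalComplex.exactAt_iff_isZero_homology,
      ← (P.isoExt (R := R) (n+1) Y).isZero_iff, ModuleCat.isZero_iff_subsingleton]
  rw [h1, HomologicalComplex.exactAt_iff' _ n (n+1) (n+2) (by simp) (by simp),
    ShortComplex.moduleCat_exact_iff]
  rfl


theorem exists_aug {R : Type} [CommRing R] {K : ModuleCat.{0} R} (P : ProjectiveResolution K) :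
    ∃ (e : P.complex.X 0 ⟶ K) (w : P.complex.d 1 0 ≫ e = 0), Epi e ∧
      (ShortComplex.mk _ _ w).Exact :=
  ⟨P.π.f 0, P.complex_d_comp_π_f_zero, inferInstanceAs (Epi (P.π.f 0)), P.exact₀⟩

theorem exists_splice {R : Type} [CommRing R] {F N K : ModuleCat.{0} R} [Projective F]
    (i : K ⟶ F) (g : F ⟶ N) [Mono i] [Epi g] (w : i ≫ g = 0)
    (hE : (ShortComplex.mk i g w).Exact)
    (P : ProjectiveResolution K) (e : P.complex.X 0 ⟶ K) (we : P.complex.d 1 0 ≫ e = 0)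
    [Epi e] (he : (ShortComplex.mk _ _ we).Exact)
    (we' : P.complex.d 1 0 ≫ (e ≫ i) = 0) :
    ∃ Q : ProjectiveResolution N, Q.complex = ChainComplex.augment P.complex (e ≫ i) we' := by
  have hw : (ChainComplex.augment P.complex (e ≫ i) we').d 1 0 ≫ g = 0 := by
    change (e ≫ i) ≫ g = 0
    rw [Category.assoc, w, Limits.comp_zero]
  refine ⟨
  { complex := ChainComplex.augment P.complex (e ≫ i) we'
    projective := ?_
    π := (ChainComplex.toSingle₀Equiv _ _).symm ⟨g, hw⟩
    quasiIso := ⟨fun n => ?_⟩ }, rfl⟩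
  · rintro (_|n)
    · exact ‹Projective F›
    · exact P.projective n
  · rcases n with _ | _ | n
    · rw [ChainComplex.quasiIsoAt₀_iff, ShortComplex.quasiIso_iff_of_zeros']
      · refine (ShortComplex.exact_and_epi_g_iff_of_iso
          (S₂ := ShortComplex.mk _ _ hw) ?_).2 ⟨?_, ‹Epi g›⟩
        · exact ShortComplex.isoMk (Iso.refl _) (Iso.refl _) (Iso.refl _)
            ((Category.id_comp _).trans (Category.comp_id _).symm)
            (by
              refine (Category.id_comp _).trans ?_
              refine Eq.trans ?_ (Category.comp_id _).symm
              exact (ChainComplex.toSingle₀Equiv_symm_apply_f_zero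
                (C := ChainComplex.augment P.complex (e ≫ i) we') g hw).symm)
        · rw [ShortComplex.moduleCat_exact_iff] at hE ⊢
          intro x hx
          obtain ⟨y, hy⟩ := hE x hx
          obtain ⟨z, hz⟩ := (ModuleCat.epi_iff_surjective e).1 inferInstance y
          refine ⟨z, ?_⟩
          change i (e z) = x
          rw [hz]; exact hy
      all_goals rfl
    · rw [quasiIsoAt_iff_exactAt' _ _ (ChainComplex.exactAt_succ_single_obj _ _)]
      rw [HomologicalComplex.exactAt_iff' _ 2 1 0 (by simp) (by simp)]
      rw [ShortComplex.moduleCat_exact_iff] at he ⊢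
      intro x hx
      apply he x
      apply (ModuleCat.mono_iff_injective i).1 inferInstance
      change i (e x) = 0 at hx
      change i (e x) = i 0
      rw [hx, map_zero]
    · rw [quasiIsoAt_iff_exactAt' _ _ (ChainComplex.exactAt_succ_single_obj _ _)]
      rw [HomologicalComplex.exactAt_iff' _ (n+3) (n+2) (n+1) (by simp) (by simp)]
      exact P.exact_succ n

theorem ext_shift {R : Type} [CommRing R] {F N K : ModuleCat.{0} R} [Projective F]
    (i : K ⟶ F) (g : F ⟶ N) [Mono i] [Epi g] (w : i ≫ g = 0)
    (hE : (ShortComplex.mk i g w).Exact) (Y : ModuleCat.{0} R) :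
    (∀ n, ExtZero R (n+2) N Y → ExtZero R (n+1) K Y) ∧
    (ExtZero R 1 N Y → ∀ φ : K ⟶ Y, ∃ ψ : F ⟶ Y, i ≫ ψ = φ) := by
  let P := ProjectiveResolution.of K
  obtain ⟨e, we, h1, h2⟩ := exists_aug P
  have we' : P.complex.d 1 0 ≫ (e ≫ i) = 0 := by
    rw [← Category.assoc, we, Limits.zero_comp]
  obtain ⟨Q, hQ⟩ := exists_splice i g w hE P e we h2 we'
  refine ⟨fun n h => ?_, fun h φ => ?_⟩
  · rw [extZero_iff Q, hQ] at h
    rw [extZero_iff P]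
    exact h
  · rw [extZero_iff Q, hQ] at h
    obtain ⟨ψ, hψ⟩ := h (e ≫ φ) (by
      change P.complex.d 1 0 ≫ (e ≫ φ) = 0
      rw [← Category.assoc, we, Limits.zero_comp])
    have key : ∀ ψ : F ⟶ Y, (e ≫ i) ≫ ψ = e ≫ φ → i ≫ ψ = φ := by
      intro ψ hψ
      rwa [Category.assoc, cancel_epi] at hψ
    exact ⟨ψ, key ψ hψ⟩

theorem ext_shift_lin {R : Type} [CommRing R] {N K : ModuleCat.{0} R} {q : ℕ}
    (i : K →ₗ[R] (Fin q → R)) (g : (Fin q → R) →ₗ[R] N) (hi : Function.Injective i)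
    (hg : Function.Surjective g) (hE : LinearMap.range i = LinearMap.ker g) :
    (∀ n, ExtZero R (n+2) N (ModuleCat.of R R) → ExtZero R (n+1) K (ModuleCat.of R R)) ∧
    (ExtZero R 1 N (ModuleCat.of R R) → ∀ φ : K →ₗ[R] R, ∃ ψ : (Fin q → R) →ₗ[R] R,
      ψ ∘ₗ i = φ) := by
  have : Projective (ModuleCat.of R (Fin q → R)) :=
    ModuleCat.projective_of_free (Pi.basisFun R (Fin q))
  let i' : K ⟶ ModuleCat.of R (Fin q → R) := ModuleCat.ofHom i
  let g' : ModuleCat.of R (Fin q → R) ⟶ N := ModuleCat.ofHom g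
  have : Mono i' := (ModuleCat.mono_iff_injective i').2 hi
  have : Epi g' := (ModuleCat.epi_iff_surjective g').2 hg
  have w : i' ≫ g' = 0 := by
    ext x
    have : i x ∈ LinearMap.ker g := hE ▸ LinearMap.mem_range_self i x
    exact this
  have hex : (ShortComplex.mk i' g' w).Exact := by
    rw [ShortComplex.moduleCat_exact_iff]
    intro x hx
    have : x ∈ LinearMap.range i := hE ▸ (show x ∈ LinearMap.ker g from hx)
    exact this
  obtain ⟨h1, h2⟩ := ext_shift i' g' w hex (ModuleCat.of R R)
  refine ⟨h1, fun h φ => ?_⟩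
  obtain ⟨ψ, hψ⟩ := h2 h (ModuleCat.ofHom φ)
  refine ⟨ψ.hom, ?_⟩
  have := congrArg ModuleCat.Hom.hom hψ
  exact this
theorem min_cover {R : Type} [CommRing R] [IsLocalRing R] {A A' : Type}
    [AddCommGroup A] [Module R A] [AddCommGroup A'] [Module R A'] {q q' : ℕ}
    (g : (Fin q → R) →ₗ[R] A) (g' : (Fin q' → R) →ₗ[R] A') (e : A ≃ₗ[R] A')
    (hg : Function.Surjective g) (hg' : Function.Surjective g')
    (hk : LinearMap.ker g ≤ (maximalIdeal R) • ⊤) (hk' : LinearMap.ker g' ≤ (maximalIdeal R) • ⊤) :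
    ∃ α : (Fin q → R) ≃ₗ[R] (Fin q' → R), ∀ x, g' (α x) = e (g x) := by
  have lift : ∀ {B B' : Type} [AddCommGroup B] [Module R B] [AddCommGroup B'] [Module R B']
      {q q' : ℕ} (g : (Fin q → R) →ₗ[R] B) (g' : (Fin q' → R) →ₗ[R] B') (e : B ≃ₗ[R] B')
      (_ : Function.Surjective g) (_ : Function.Surjective g')
      (_ : LinearMap.ker g' ≤ (maximalIdeal R) • ⊤),
      ∃ α : (Fin q → R) →ₗ[R] (Fin q' → R), (∀ x, g' (α x) = e (g x)) ∧
        Function.Surjective α := by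
    intro B B' _ _ _ _ q q' g g' e hg hg' hk'
    obtain ⟨α, hα⟩ := Module.projective_lifting_property g' (e.toLinearMap ∘ₗ g) hg'
    have hα' : ∀ x, g' (α x) = e (g x) := fun x => LinearMap.congr_fun hα x
    refine ⟨α, hα', ?_⟩
    rw [← LinearMap.range_eq_top, ← top_le_iff]
    apply Submodule.le_of_le_smul_of_le_jacobson_bot (I := maximalIdeal R) Module.Finite.fg_top
      (maximalIdeal_le_jacobson _)
    intro y _
    obtain ⟨x, hx⟩ := hg (e.symm (g' y))
    have : y - α x ∈ LinearMap.ker g' := by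
      rw [LinearMap.mem_ker, map_sub, hα', hx, e.apply_symm_apply, sub_self]
    exact Submodule.mem_sup.2 ⟨α x, ⟨x, rfl⟩, y - α x, hk' this, by abel⟩
  obtain ⟨α, hα, hs⟩ := lift g g' e hg hg' hk'
  obtain ⟨β, hβ, hs'⟩ := lift g' g e.symm hg' hg hk
  have hinj : Function.Injective (β ∘ₗ α) :=
    OrzechProperty.injective_of_surjective_endomorphism (β ∘ₗ α) (by
      rw [LinearMap.coe_comp]; exact hs'.comp hs)
  have hi : Function.Injective α := by
    rw [LinearMap.coe_comp] at hinj
    exact hinj.of_comp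
  exact ⟨LinearEquiv.ofBijective α ⟨hi, hs⟩, hα⟩

theorem coker_unique {R : Type} [CommRing R] [IsLocalRing R] {A A' : Type}
    [AddCommGroup A] [Module R A] [AddCommGroup A'] [Module R A'] {q q' p p' : ℕ}
    (g : (Fin q → R) →ₗ[R] A) (g' : (Fin q' → R) →ₗ[R] A') (e : A ≃ₗ[R] A')
    (f : (Fin p → R) →ₗ[R] (Fin q → R)) (f' : (Fin p' → R) →ₗ[R] (Fin q' → R))
    (hg : Function.Surjective g) (hg' : Function.Surjective g')
    (hr : LinearMap.range f = LinearMap.ker g) (hr' : LinearMap.range f' = LinearMap.ker g')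
    (hk : LinearMap.ker g ≤ (maximalIdeal R) • ⊤) (hk' : LinearMap.ker g' ≤ (maximalIdeal R) • ⊤)
    (hf : LinearMap.ker f ≤ (maximalIdeal R) • ⊤) (hf' : LinearMap.ker f' ≤ (maximalIdeal R) • ⊤) :
    Nonempty ((Module.Dual R (Fin p → R) ⧸ LinearMap.range f.dualMap) ≃ₗ[R]
      (Module.Dual R (Fin p' → R) ⧸ LinearMap.range f'.dualMap)) := by
  obtain ⟨α, hα⟩ := min_cover g g' e hg hg' hk hk'
  have hmap : (LinearMap.range f).map (α : (Fin q → R) →ₗ[R] (Fin q' → R)) = LinearMap.range f' := by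
    rw [hr, hr']
    ext y
    constructor
    · rintro ⟨x, hx, rfl⟩
      have hx' : g x = 0 := hx
      change g' (α x) = 0
      rw [hα, hx', map_zero]
    · intro hy
      have hy' : g' y = 0 := hy
      refine ⟨α.symm y, ?_, α.apply_symm_apply y⟩
      change g (α.symm y) = 0
      apply e.injective
      rw [← hα, α.apply_symm_apply, hy', map_zero]
  let e' : LinearMap.range f ≃ₗ[R] LinearMap.range f' := α.ofSubmodules _ _ hmap
  obtain ⟨β, hβ⟩ := min_cover f.rangeRestrict f'.rangeRestrict e'
    f.surjective_rangeRestrict f'.surjective_rangeRestrict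
    (by rwa [LinearMap.ker_rangeRestrict]) (by rwa [LinearMap.ker_rangeRestrict])
  have hβ' : ∀ x, f' (β x) = α (f x) := fun x => congrArg Subtype.val (hβ x)
  refine ⟨Submodule.Quotient.equiv _ _ β.symm.dualMap ?_⟩
  ext φ
  constructor
  · rintro ⟨_, ⟨ψ, rfl⟩, rfl⟩
    refine ⟨ψ ∘ₗ α.symm.toLinearMap, ?_⟩
    apply LinearMap.ext
    intro x
    obtain ⟨x, rfl⟩ := β.surjective x
    simp [hβ']
  · rintro ⟨ψ, rfl⟩
    refine ⟨f.dualMap (ψ ∘ₗ α.toLinearMap), ⟨_, rfl⟩, ?_⟩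
    apply LinearMap.ext
    intro x
    obtain ⟨x, rfl⟩ := β.surjective x
    simp [hβ']

theorem schanuel {R : Type} [CommRing R] {A X Y : Type}
    [AddCommGroup A] [Module R A] [AddCommGroup X] [Module R X] [AddCommGroup Y] [Module R Y]
    [Module.Projective R X] [Module.Projective R Y]
    (u : X →ₗ[R] A) (v : Y →ₗ[R] A) (hu : Function.Surjective u) (hv : Function.Surjective v) :
    Nonempty ((LinearMap.ker u × Y) ≃ₗ[R] (LinearMap.ker v × X)) := by
  obtain ⟨s, hs⟩ := Module.projective_lifting_property u v hu
  obtain ⟨t, ht⟩ := Module.projective_lifting_property v u hv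
  have hs' : ∀ y, u (s y) = v y := fun y => LinearMap.congr_fun hs y
  have ht' : ∀ x, v (t x) = u x := fun x => LinearMap.congr_fun ht x
  -- pullback point of `(k, y)` is `(k + s y, y)`, and of `(l, x)` is `(x, l + t x)`
  let F : (LinearMap.ker u × Y) →ₗ[R] X := (LinearMap.ker u).subtype.coprod s
  let G : (LinearMap.ker v × X) →ₗ[R] Y := (LinearMap.ker v).subtype.coprod t
  have hF : ∀ z, u (F z) = v z.2 := by
    rintro ⟨k, y⟩
    have hk : u k = 0 := k.2
    simp [F, hs', hk]
  have hG : ∀ z, v (G z) = u z.2 := by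
    rintro ⟨k, y⟩
    have hk : v k = 0 := k.2
    simp [G, ht', hk]
  let F1 : (LinearMap.ker u × Y) →ₗ[R] LinearMap.ker v :=
    LinearMap.codRestrict _ (LinearMap.snd R _ _ - t ∘ₗ F) (by
      intro z
      rw [LinearMap.mem_ker]
      simp [ht', hF])
  let G1 : (LinearMap.ker v × X) →ₗ[R] LinearMap.ker u :=
    LinearMap.codRestrict _ (LinearMap.snd R _ _ - s ∘ₗ G) (by
      intro z
      rw [LinearMap.mem_ker]
      simp [hs', hG])
  refine ⟨LinearEquiv.ofLinearMap (F1.prod F) (G1.prod G) ?_ ?_⟩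
  · apply LinearMap.ext
    rintro ⟨k, y⟩
    ext <;> simp [F1, G1, F, G]
  · apply LinearMap.ext
    rintro ⟨k, y⟩
    ext <;> simp [F1, G1, F, G]

theorem ker_prodMap_equiv {R : Type} [CommRing R] {A B X Y : Type}
    [AddCommGroup A] [Module R A] [AddCommGroup X] [Module R X] [AddCommGroup Y] [Module R Y]
    [AddCommGroup B] [Module R B]
    (g : X →ₗ[R] A) (e : (A × Y) ≃ₗ[R] B) :
    Nonempty (LinearMap.ker g ≃ₗ[R]
      LinearMap.ker (e.toLinearMap ∘ₗ (g.prodMap (LinearMap.id : Y →ₗ[R] Y)))) := by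
  refine ⟨LinearEquiv.ofBijective (LinearMap.codRestrict _
    (LinearMap.inl R X Y ∘ₗ (LinearMap.ker g).subtype) ?_) ⟨?_, ?_⟩⟩
  · intro x
    have hx : g x = 0 := x.2
    rw [LinearMap.mem_ker]
    simp [hx]
  · intro x y h
    have := congrArg Subtype.val h
    simpa using this
  · rintro ⟨⟨x, y⟩, h⟩
    rw [LinearMap.mem_ker] at h
    simp at h
    refine ⟨⟨x, h.1⟩, ?_⟩
    ext1
    simp [h.2]

theorem prodFin {R : Type} [CommRing R] (a b : ℕ) :
    Nonempty (((Fin a → R) × (Fin b → R)) ≃ₗ[R] (Fin (a + b) → R)) :=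
  ⟨(LinearEquiv.sumArrowLequivProdArrow (Fin a) (Fin b) R R).symm ≪≫ₗ
    LinearEquiv.funCongrLeft R R finSumFinEquiv.symm⟩

section
variable {R : Type} [CommRing R]

theorem StablyIso.symm {A B : ModuleCat.{0} R} (h : StablyIso R A B) : StablyIso R B A := by
  obtain ⟨p, q, ⟨e⟩⟩ := h
  exact ⟨q, p, ⟨e.symm⟩⟩

theorem StablyIso.of_equiv {A B : ModuleCat.{0} R} (e : A ≃ₗ[R] B) : StablyIso R A B :=
  ⟨0, 0, ⟨e.prodCongr (LinearEquiv.refl R _)⟩⟩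

theorem StablyIso.trans {A B C : ModuleCat.{0} R} (h : StablyIso R A B) (h' : StablyIso R B C) :
    StablyIso R A C := by
  obtain ⟨p, q, ⟨e⟩⟩ := h
  obtain ⟨p', q', ⟨e'⟩⟩ := h'
  obtain ⟨c⟩ := prodFin (R := R) p p'
  obtain ⟨d⟩ := prodFin (R := R) q' q
  refine ⟨p + p', q' + q, ⟨?_⟩⟩
  exact (LinearEquiv.refl R A).prodCongr c.symm ≪≫ₗ
    (LinearEquiv.prodAssoc R A (Fin p → R) (Fin p' → R)).symm ≪≫ₗ
    e.prodCongr (LinearEquiv.refl R _) ≪≫ₗ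
    LinearEquiv.prodAssoc R B (Fin q → R) (Fin p' → R) ≪≫ₗ
    (LinearEquiv.refl R B).prodCongr (LinearEquiv.prodComm R _ _) ≪≫ₗ
    (LinearEquiv.prodAssoc R B (Fin p' → R) (Fin q → R)).symm ≪≫ₗ
    e'.prodCongr (LinearEquiv.refl R _) ≪≫ₗ
    LinearEquiv.prodAssoc R C (Fin q' → R) (Fin q → R) ≪≫ₗ
    (LinearEquiv.refl R C).prodCongr d

theorem StablyIso.ker {A A' M M' : ModuleCat.{0} R} (h : StablyIso R A A') {a a' : ℕ}
    (g : (Fin a → R) →ₗ[R] A) (g' : (Fin a' → R) →ₗ[R] A')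
    (hg : Function.Surjective g) (hg' : Function.Surjective g')
    (i : M ≃ₗ[R] LinearMap.ker g) (i' : M' ≃ₗ[R] LinearMap.ker g') : StablyIso R M M' := by
  obtain ⟨p, q, ⟨e⟩⟩ := h
  obtain ⟨j⟩ := ker_prodMap_equiv g e
  obtain ⟨j'⟩ := ker_prodMap_equiv (Y := Fin q → R) g' (LinearEquiv.refl R _)
  obtain ⟨s⟩ := schanuel (e.toLinearMap ∘ₗ g.prodMap (LinearMap.id : (Fin p → R) →ₗ[R] _))
    ((LinearEquiv.refl R _).toLinearMap ∘ₗ g'.prodMap (LinearMap.id : (Fin q → R) →ₗ[R] _))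
    (by
      rw [LinearMap.coe_comp]
      exact e.surjective.comp (by
        rw [LinearMap.coe_prodMap]; exact hg.prodMap Function.surjective_id))
    (by
      rw [LinearMap.coe_comp]
      exact (LinearEquiv.refl R _).surjective.comp (by
        rw [LinearMap.coe_prodMap]; exact hg'.prodMap Function.surjective_id))
  obtain ⟨c⟩ := prodFin (R := R) a' q
  obtain ⟨d⟩ := prodFin (R := R) a p
  exact ⟨a' + q, a + p, ⟨(i ≪≫ₗ j).prodCongr c.symm ≪≫ₗ s ≪≫ₗ
    ((i' ≪≫ₗ j').prodCongr d.symm).symm⟩⟩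

variable [IsLocalRing R]

theorem IsTransposeOf.unique {A A' T T' : ModuleCat.{0} R} (e : A ≃ₗ[R] A')
    (h : IsTransposeOf R A T) (h' : IsTransposeOf R A' T') : StablyIso R T T' := by
  obtain ⟨q, p, g, f, h1, h2, h3, h4, ⟨i⟩⟩ := h
  obtain ⟨q', p', g', f', h1', h2', h3', h4', ⟨i'⟩⟩ := h'
  obtain ⟨c⟩ := coker_unique g g' e f f' h1 h1' h2 h2' h3 h3' h4 h4'
  exact StablyIso.of_equiv (i ≪≫ₗ c ≪≫ₗ i'.symm)

theorem ker_mkQ_equiv {V W Z T : Type} [AddCommGroup V] [Module R V] [AddCommGroup W] [Module R W]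
    [AddCommGroup Z] [Module R Z] [AddCommGroup T] [Module R T]
    (b : V ≃ₗ[R] W) (r : Z →ₗ[R] W) (i : (W ⧸ LinearMap.range r) ≃ₗ[R] T) :
    Nonempty ((Z ⧸ LinearMap.ker r) ≃ₗ[R]
      LinearMap.ker (i.toLinearMap ∘ₗ (LinearMap.range r).mkQ ∘ₗ b.toLinearMap)) := by
  refine ⟨r.quotKerEquivRange ≪≫ₗ b.symm.ofSubmodules _ _ ?_⟩
  ext x
  rw [LinearMap.mem_ker]
  constructor
  · rintro ⟨y, hy, rfl⟩
    have : (Submodule.Quotient.mk y : W ⧸ LinearMap.range r) = 0 :=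
      (Submodule.Quotient.mk_eq_zero _).2 hy
    simp [this]
  · intro hx
    have hx' : i (Submodule.Quotient.mk (b x)) = 0 := hx
    rw [map_eq_zero_iff _ i.injective, Submodule.Quotient.mk_eq_zero] at hx'
    exact ⟨b x, hx', b.symm_apply_apply x⟩

theorem key_step {D C T T' K' : ModuleCat.{0} R} (hTT : StablyIso R T' T) (hD : ExtZero R 1 D (ModuleCat.of R R))
    (hC : IsSyzygyOf R D C) (hT : IsTransposeOf R C T) (hK : IsSyzygyOf R T' K') :
    ∃ TD : ModuleCat.{0} R, IsTransposeOf R D TD ∧ StablyIso R K' TD := by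
  obtain ⟨q, g, hg, hgk, ⟨eC⟩⟩ := hC
  obtain ⟨q1, p1, h, f, hh, hr, hhk, hfk, ⟨eT⟩⟩ := hT
  obtain ⟨s, k, hk, -, ⟨eK⟩⟩ := hK
  let i : C →ₗ[R] (Fin q → R) := (LinearMap.ker g).subtype ∘ₗ eC.toLinearMap
  have hi : Function.Injective i := by
    intro x y hxy
    exact eC.injective (Subtype.ext hxy)
  have hir : LinearMap.range i = LinearMap.ker g := by
    simp [i, LinearMap.range_comp]
  let d : (Fin q1 → R) →ₗ[R] (Fin q → R) := i ∘ₗ h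
  have hdr : LinearMap.range d = LinearMap.ker g := by
    rw [LinearMap.range_comp_of_range_eq_top _ (LinearMap.range_eq_top.2 hh), hir]
  have hdk : LinearMap.ker d = LinearMap.ker h :=
    LinearMap.ker_comp_of_ker_eq_bot _ (LinearMap.ker_eq_bot.2 hi)
  have hker : LinearMap.ker f.dualMap = LinearMap.range d.dualMap := by
    ext φ
    constructor
    · intro hφ
      have hφ' : φ ∘ₗ f = 0 := hφ
      have hle : LinearMap.ker h ≤ LinearMap.ker φ := by
        rw [← hr]
        rintro _ ⟨x, rfl⟩
        exact LinearMap.congr_fun hφ' x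
      let φ' : C →ₗ[R] R := (LinearMap.ker h).liftQ φ hle ∘ₗ
        (h.quotKerEquivOfSurjective hh).symm.toLinearMap
      have hφ'' : ∀ x, φ' (h x) = φ x := by
        intro x
        have : (h.quotKerEquivOfSurjective hh).symm (h x) = Submodule.Quotient.mk x := by
          rw [LinearEquiv.symm_apply_eq]; rfl
        simp [φ', this]
      obtain ⟨ψ, hψ⟩ := (ext_shift_lin i g hi hg hir).2 hD φ'
      refine ⟨ψ, ?_⟩
      apply LinearMap.ext
      intro x
      rw [← hφ'' x, ← hψ]
      rfl
    · rintro ⟨ψ, rfl⟩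
      rw [LinearMap.mem_ker]
      apply LinearMap.ext
      intro x
      have : f x ∈ LinearMap.ker h := hr ▸ LinearMap.mem_range_self f x
      have : h (f x) = 0 := this
      simp [d, this]
  refine ⟨ModuleCat.of R (Module.Dual R (Fin q1 → R) ⧸ LinearMap.range d.dualMap),
    ⟨q, q1, g, d, hg, hdr, hgk, hdk ▸ hhk, ⟨LinearEquiv.refl R _⟩⟩, ?_⟩
  obtain ⟨j⟩ := ker_mkQ_equiv (Pi.basisFun R (Fin p1)).toDualEquiv f.dualMap eT.symm
  refine StablyIso.ker hTT k _ hk ?_ eK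
    (Submodule.quotEquivOfEq _ _ hker.symm ≪≫ₗ j)
  rw [LinearMap.coe_comp, LinearMap.coe_comp]
  exact eT.symm.surjective.comp ((Submodule.mkQ_surjective _).comp (LinearEquiv.surjective _))

theorem IsSyzygyOf.ext_shift {N K : ModuleCat.{0} R} (h : IsSyzygyOf R N K) (n : ℕ)
    (hN : ExtZero R (n + 2) N (ModuleCat.of R R)) : ExtZero R (n + 1) K (ModuleCat.of R R) := by
  obtain ⟨q, g, hg, hgk, ⟨eC⟩⟩ := h
  refine (ext_shift_lin ((LinearMap.ker g).subtype ∘ₗ eC.toLinearMap) g ?_ hg ?_).1 n hN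
  · intro x y hxy
    exact eC.injective (Subtype.ext hxy)
  · simp [LinearMap.range_comp]

/-- peel off the last syzygy -/
theorem IsNthSyzygyOf.last (n : ℕ) : ∀ {N C : ModuleCat.{0} R}, IsNthSyzygyOf R (n + 1) N C →
    ∃ D, IsNthSyzygyOf R n N D ∧ IsSyzygyOf R D C ∧
      (ExtZero R (n + 1) N (ModuleCat.of R R) → ExtZero R 1 D (ModuleCat.of R R)) := by
  induction n with
  | zero =>
    rintro N C ⟨K, ⟨q, g, h1, h2, ⟨e⟩⟩, ⟨e'⟩⟩
    exact ⟨N, ⟨LinearEquiv.refl R _⟩, ⟨q, g, h1, h2, ⟨e' ≪≫ₗ e⟩⟩, id⟩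
  | succ n ih =>
    rintro N C ⟨K, hK, hC⟩
    obtain ⟨D, h1, h2, h3⟩ := ih hC
    exact ⟨D, ⟨K, hK, h1⟩, h2, fun h => h3 (hK.ext_shift n h)⟩

theorem main_induction {N T0 : ModuleCat.{0} R} (hT0 : IsTransposeOf R N T0) (n : ℕ) :
    (∀ i : ℕ, 1 ≤ i → i ≤ n → ExtZero R i N (ModuleCat.of R R)) →
    ∀ {C T T' S : ModuleCat.{0} R}, StablyIso R T' T → IsNthSyzygyOf R n N C →
      IsTransposeOf R C T → IsNthSyzygyOf R n T' S → StablyIso R S T0 := by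
  induction n with
  | zero =>
    rintro - C T T' S h ⟨e⟩ hT ⟨e'⟩
    exact ((StablyIso.of_equiv e').trans h).trans (IsTransposeOf.unique e hT hT0)
  | succ n ih =>
    rintro hExt C T T' S h hC hT ⟨K', hK', hS⟩
    obtain ⟨D, h1, h2, h3⟩ := IsNthSyzygyOf.last n hC
    obtain ⟨TD, h4, h5⟩ := key_step h (h3 (hExt (n + 1) (by omega) le_rfl)) h2 hT hK'
    exact ih (fun i hi hi' => hExt i hi (by omega)) h5 h1 h4 hS

end

/-- if `Ext^i(N, R) = 0` for `i = 1, …, n` then `Ω^n Tr Ω^n N` is stably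
isomorphic to `Tr N`; in particular `Tr N` is (stably) an `n`-th syzygy. -/
theorem transpose_nth_syzygy
    (R : Type) [CommRing R] [IsNoetherianRing R] [IsLocalRing R]
    (N : ModuleCat.{0} R) [Module.Finite R N]
    (n : ℕ) (hn : 1 ≤ n)
    (hExt : ∀ i : ℕ, 1 ≤ i → i ≤ n → ExtZero R i N (ModuleCat.of R R))
    (C : ModuleCat.{0} R) (hC : IsNthSyzygyOf R n N C)
    (T : ModuleCat.{0} R) (hT : IsTransposeOf R C T)
    (S : ModuleCat.{0} R) (hS : IsNthSyzygyOf R n T S)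
    (T0 : ModuleCat.{0} R) (hT0 : IsTransposeOf R N T0) :
    StablyIso R S T0 ∧
      ∃ Y W : ModuleCat.{0} R, IsNthSyzygyOf R n Y W ∧ StablyIso R T0 W := by
  have h := main_induction hT0 n hExt (StablyIso.of_equiv (LinearEquiv.refl R T)) hC hT hS
  exact ⟨h, T, S, hS, h.symm⟩
end
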